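/- arXiv:1507.03866 — 2 statements merged into one kernel-verified Lean document; each statement's English description precedes it below -/
import Mathlib

section
/- Let F be a Siegel modular form of weight k for Sp₄ₙ(ℤ) on ℍ_{2n}. Write Z ∈ ℍ_{2n} in blocks Z = (W, u; ᵀu, τ) with W ∈ ℍ_{2n−1}, u ∈ ℂ^{2n−1}, τ ∈ ℍ, and let F(Z) = Σ_S F_S(τ,u) e^{2πi·tr(SW)} be the Fourier–Jacobi expansion, the sum running over positive semidefinite half-integral symmetric (2n−1)×(2n−1) matrices S. Then for every positive definite such S, the Fourier–Jacobi coefficient F_S(τ,u) is a Jacobi form of weight k and index S on ℍ×ℂ^{2n−1}. -/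
open Matrix Complex

noncomputable section

/-- `e z = exp(2 π i z)`. -/
def eFun (z : ℂ) : ℂ := Complex.exp (2 * Real.pi * Complex.I * z)

section Siegel

variable {ι : Type} [Fintype ι] [DecidableEq ι]

/-- The Siegel upper half space, indexed by an arbitrary finite type. -/
def SiegelHalfSpace (ι : Type) [Fintype ι] [DecidableEq ι] : Set (Matrix ι ι ℂ) :=
  {Z | Z.IsSymm ∧ (Z.map Complex.im).PosDef}

def IsHalfIntegral {ι : Type} [Fintype ι] (T : Matrix ι ι ℚ) : Prop :=
  T.IsSymm ∧ (∀ i, ∃ z : ℤ, T i i = (z : ℚ)) ∧ (∀ i j, ∃ z : ℤ, 2 * T i j = (z : ℚ))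

def PosDefQ {ι : Type} [Fintype ι] (T : Matrix ι ι ℚ) : Prop :=
  (T.map (fun q => (q : ℝ))).PosDef

def PosSemidefQ {ι : Type} [Fintype ι] (T : Matrix ι ι ℚ) : Prop :=
  (T.map (fun q => (q : ℝ))).PosSemidef

def trPair (T : Matrix ι ι ℚ) (Z : Matrix ι ι ℂ) : ℂ :=
  ((T.map (fun q => (q : ℂ))) * Z).trace

def Jmat (ι : Type) [Fintype ι] [DecidableEq ι] : Matrix (ι ⊕ ι) (ι ⊕ ι) ℤ :=
  fromBlocks 0 1 (-1) 0

/-- `Sp(ℤ) = {g : ᵀg J g = J}`. -/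
def SpSet (ι : Type) [Fintype ι] [DecidableEq ι] : Set (Matrix (ι ⊕ ι) (ι ⊕ ι) ℤ) :=
  {g | gᵀ * Jmat ι * g = Jmat ι}

def blkA (g : Matrix (ι ⊕ ι) (ι ⊕ ι) ℤ) : Matrix ι ι ℂ :=
  (g.map (fun z : ℤ => (z : ℂ))).toBlocks₁₁
def blkB (g : Matrix (ι ⊕ ι) (ι ⊕ ι) ℤ) : Matrix ι ι ℂ :=
  (g.map (fun z : ℤ => (z : ℂ))).toBlocks₁₂
def blkC (g : Matrix (ι ⊕ ι) (ι ⊕ ι) ℤ) : Matrix ι ι ℂ :=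
  (g.map (fun z : ℤ => (z : ℂ))).toBlocks₂₁
def blkD (g : Matrix (ι ⊕ ι) (ι ⊕ ι) ℤ) : Matrix ι ι ℂ :=
  (g.map (fun z : ℤ => (z : ℂ))).toBlocks₂₂

def actSp (g : Matrix (ι ⊕ ι) (ι ⊕ ι) ℤ) (Z : Matrix ι ι ℂ) : Matrix ι ι ℂ :=
  (blkA g * Z + blkB g) * (blkC g * Z + blkD g)⁻¹

def jfac (g : Matrix (ι ⊕ ι) (ι ⊕ ι) ℤ) (Z : Matrix ι ι ℂ) : ℂ :=
  (blkC g * Z + blkD g).det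

def HoloOn (F : Matrix ι ι ℂ → ℂ) (U : Set (Matrix ι ι ℂ)) : Prop :=
  DifferentiableOn ℂ (fun Z : ι → ι → ℂ => F (Matrix.of Z)) (Matrix.of ⁻¹' U)

end Siegel

section Jacobi

def sigmaC {m : ℕ} (S : Matrix (Fin m) (Fin m) ℚ) (x y : Fin m → ℂ) : ℂ :=
  x ⬝ᵥ ((S.map (fun q => (q : ℂ))) *ᵥ y)

/-- The bordered matrix `S_{ξ,N} = (S, Sξ; ᵀξS, N)`. -/
def borderMat {m : ℕ} (S : Matrix (Fin m) (Fin m) ℚ) (ξ : Fin m → ℚ) (N : ℚ) :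
    Matrix (Fin m ⊕ Unit) (Fin m ⊕ Unit) ℚ :=
  fun p q =>
    match p, q with
    | Sum.inl i, Sum.inl j => S i j
    | Sum.inl i, Sum.inr _ => (S *ᵥ ξ) i
    | Sum.inr _, Sum.inl j => (ξ ᵥ* S) j
    | Sum.inr _, Sum.inr _ => N

/-- A Jacobi form of weight `k` and index `S` with Fourier coefficients `c`. -/
def IsJacobiForm (m : ℕ) (k : ℤ) (S : Matrix (Fin m) (Fin m) ℚ)
    (φ : ℂ × (Fin m → ℂ) → ℂ) (c : ℤ → (Fin m → ℚ) → ℂ) : Prop :=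
  DifferentiableOn ℂ φ {p | 0 < p.1.im} ∧
  (∀ ga gb gc gd : ℤ, ga * gd - gb * gc = 1 →
    ∀ τ : ℂ, 0 < τ.im → ∀ u : Fin m → ℂ,
      φ (((ga : ℂ) * τ + gb) / ((gc : ℂ) * τ + gd), fun i => u i / ((gc : ℂ) * τ + gd)) =
        ((gc : ℂ) * τ + gd) ^ k *
          eFun ((gc : ℂ) * sigmaC S u u / ((gc : ℂ) * τ + gd)) * φ (τ, u)) ∧
  (∀ x y : Fin m → ℤ, ∀ τ : ℂ, 0 < τ.im → ∀ u : Fin m → ℂ,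
    φ (τ, fun i => u i + (x i : ℂ) * τ + (y i : ℂ)) =
      eFun (-(sigmaC S (fun i => (x i : ℂ)) (fun i => (x i : ℂ)) * τ
        + 2 * sigmaC S (fun i => (x i : ℂ)) u)) * φ (τ, u)) ∧
  (∀ τ : ℂ, 0 < τ.im → ∀ u : Fin m → ℂ,
    HasSum (fun Nξ : ℤ × (Fin m → ℚ) =>
      c Nξ.1 Nξ.2 * eFun ((Nξ.1 : ℂ) * τ + 2 * sigmaC S (fun i => ((Nξ.2 i : ℂ))) u))
      (φ (τ, u))) ∧
  (∀ N : ℤ, ∀ ξ : Fin m → ℚ,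
    ¬ (IsHalfIntegral (borderMat S ξ (N : ℚ)) ∧ PosSemidefQ (borderMat S ξ (N : ℚ))) →
      c N ξ = 0)

/-- The Fourier–Jacobi coefficient attached to `S`, built out of the Fourier
coefficients `A` of a Siegel modular form. -/
def fjCoeff {m : ℕ} (A : Matrix (Fin m ⊕ Unit) (Fin m ⊕ Unit) ℚ → ℂ)
    (S : Matrix (Fin m) (Fin m) ℚ) (p : ℂ × (Fin m → ℂ)) : ℂ :=
  ∑' Nξ : ℤ × (Fin m → ℚ),
    A (borderMat S Nξ.2 (Nξ.1 : ℚ)) *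
      eFun ((Nξ.1 : ℂ) * p.1 + 2 * sigmaC S (fun i => ((Nξ.2 i : ℂ))) p.2)

end Jacobi

open Filter Topology

section MeanValue

lemma tendsto_average_pow {z : ℂ} (hz : ‖z‖ = 1) :
    Tendsto (fun N : ℕ => (N : ℂ)⁻¹ * ∑ j ∈ Finset.range N, z ^ j) atTop
      (𝓝 (if z = 1 then 1 else 0)) := by
  split_ifs with h
  · subst h
    refine tendsto_const_nhds.congr' ?_
    filter_upwards [eventually_gt_atTop 0] with N hN
    have : (N : ℂ) ≠ 0 := by exact_mod_cast hN.ne'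
    simp [this]
  · have h1 : 0 < ‖z - 1‖ := norm_pos_iff.2 (sub_ne_zero.2 h)
    have hb : ∀ N : ℕ, ‖(N : ℂ)⁻¹ * ∑ j ∈ Finset.range N, z ^ j‖ ≤ (N : ℝ)⁻¹ * (2 / ‖z - 1‖) := by
      intro N
      rw [norm_mul, norm_inv, Complex.norm_natCast, geom_sum_eq h, norm_div]
      gcongr
      calc ‖z ^ N - 1‖ ≤ ‖z ^ N‖ + ‖(1 : ℂ)‖ := norm_sub_le _ _
        _ = 2 := by rw [norm_pow, hz]; norm_num
    refine squeeze_zero_norm hb ?_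
    simpa using (tendsto_inv_atTop_nhds_zero_nat (𝕜 := ℝ)).mul_const (2 / ‖z - 1‖)

lemma norm_average_pow_le {z : ℂ} (hz : ‖z‖ = 1) (N : ℕ) :
    ‖(N : ℂ)⁻¹ * ∑ j ∈ Finset.range N, z ^ j‖ ≤ 1 := by
  rw [norm_mul, norm_inv, Complex.norm_natCast]
  have h : ‖∑ j ∈ Finset.range N, z ^ j‖ ≤ N := by
    refine (norm_sum_le _ _).trans ?_
    simp [hz]
  calc (N : ℝ)⁻¹ * ‖∑ j ∈ Finset.range N, z ^ j‖ ≤ (N : ℝ)⁻¹ * N := by gcongr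
    _ ≤ 1 := inv_mul_le_one

/-- The Bohr mean of an absolutely convergent trigonometric series picks out a frequency. -/
lemma tendsto_average_tsum {I : Type*} {c z : I → ℂ} (hc : Summable c) (hz : ∀ i, ‖z i‖ = 1)
    {w : ℂ} (hw : ‖w‖ = 1) :
    Tendsto (fun N : ℕ => (N : ℂ)⁻¹ * ∑ j ∈ Finset.range N, w⁻¹ ^ j * ∑' i, c i * z i ^ j) atTop
      (𝓝 (∑' i, if z i = w then c i else 0)) := by
  have hw0 : w ≠ 0 := by rintro rfl; simp at hw
  have hn : ∀ i, ‖w⁻¹ * z i‖ = 1 := fun i => by rw [norm_mul, norm_inv, hw, hz]; norm_num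
  have hs : ∀ j : ℕ, Summable fun i => c i * z i ^ j := fun j =>
    Summable.of_norm (by simpa [norm_mul, norm_pow, hz] using hc.norm)
  have key : ∀ N : ℕ, (N : ℂ)⁻¹ * ∑ j ∈ Finset.range N, w⁻¹ ^ j * ∑' i, c i * z i ^ j =
      ∑' i, c i * ((N : ℂ)⁻¹ * ∑ j ∈ Finset.range N, (w⁻¹ * z i) ^ j) := by
    intro N
    have h1 : HasSum (fun i => (N : ℂ)⁻¹ * ∑ j ∈ Finset.range N, w⁻¹ ^ j * (c i * z i ^ j))
        ((N : ℂ)⁻¹ * ∑ j ∈ Finset.range N, w⁻¹ ^ j * ∑' i, c i * z i ^ j) :=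
      (hasSum_sum fun j _ => (hs j).hasSum.mul_left _).mul_left _
    rw [← h1.tsum_eq]
    refine tsum_congr fun i => ?_
    rw [mul_left_comm, Finset.mul_sum (a := c i)]
    congr 1
    refine Finset.sum_congr rfl fun j _ => ?_
    rw [mul_pow]; ring
  simp_rw [key]
  refine tendsto_tsum_of_dominated_convergence hc.norm (fun i => ?_) (Eventually.of_forall ?_)
  · have := (tendsto_average_pow (hn i)).const_mul (c i)
    convert this using 2
    have : w⁻¹ * z i = 1 ↔ z i = w := by
      rw [inv_mul_eq_one₀ hw0, eq_comm]
    simp only [this, mul_ite, mul_one, mul_zero]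
  · intro N i
    rw [norm_mul]
    exact mul_le_of_le_one_right (norm_nonneg _) (norm_average_pow_le (hn i) N)

lemma tsum_ite_eq_of_forall_pow {I J : Type*} {c z : I → ℂ} {c' z' : J → ℂ} (hc : Summable c)
    (hz : ∀ i, ‖z i‖ = 1) (hc' : Summable c') (hz' : ∀ i, ‖z' i‖ = 1)
    (h : ∀ j : ℕ, ∑' i, c i * z i ^ j = ∑' i, c' i * z' i ^ j) {w : ℂ} (hw : ‖w‖ = 1) :
    (∑' i, if z i = w then c i else 0) = ∑' i, if z' i = w then c' i else 0 := by
  refine tendsto_nhds_unique (tendsto_average_tsum hc hz hw) ?_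
  simp_rw [h]
  exact tendsto_average_tsum hc' hz' hw

end MeanValue

section Exponential

lemma eFun_add (x y : ℂ) : eFun (x + y) = eFun x * eFun y := by
  simp only [eFun, mul_add, Complex.exp_add]

lemma eFun_zero : eFun 0 = 1 := by simp [eFun]

lemma eFun_ne_zero (x : ℂ) : eFun x ≠ 0 := Complex.exp_ne_zero _

lemma eFun_natCast_mul (j : ℕ) (x : ℂ) : eFun (j * x) = eFun x ^ j := by
  simp only [eFun, ← Complex.exp_nat_mul]
  congr 1; ring

lemma norm_eFun (x : ℂ) : ‖eFun x‖ = Real.exp (-(2 * Real.pi * x.im)) := by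
  simp [eFun, Complex.norm_exp]

lemma norm_eFun_ofReal (x : ℝ) : ‖eFun x‖ = 1 := by
  simp [norm_eFun]

lemma eFun_eq_eFun_iff {x y : ℂ} : eFun x = eFun y ↔ ∃ k : ℤ, x = y + k := by
  have h2 : (2 * Real.pi * Complex.I : ℂ) ≠ 0 := Complex.two_pi_I_ne_zero
  rw [eFun, eFun, Complex.exp_eq_exp_iff_exists_int]
  refine exists_congr fun k => ⟨fun h => mul_left_cancel₀ h2 (by rw [h]; ring), fun h => ?_⟩
  rw [h]; ring

end Exponential

section TracePairing

variable {ι : Type} [Fintype ι]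

lemma trPair_add (T : Matrix ι ι ℚ) (Z Z' : Matrix ι ι ℂ) :
    trPair T (Z + Z') = trPair T Z + trPair T Z' := by
  simp [trPair, Matrix.mul_add]

lemma trPair_smul (T : Matrix ι ι ℚ) (a : ℂ) (Z : Matrix ι ι ℂ) :
    trPair T (a • Z) = a * trPair T Z := by
  simp [trPair]

lemma trPair_ofReal (T : Matrix ι ι ℚ) (X : Matrix ι ι ℝ) :
    trPair T (X.map ((↑) : ℝ → ℂ)) = ((T.map ((↑) : ℚ → ℝ) * X).trace : ℝ) := by
  simp [trPair, Matrix.trace, Matrix.mul_apply]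

/-- There is a real symmetric matrix whose trace pairing separates rational symmetric matrices
modulo the integers. -/
lemma exists_separating_matrix (ι : Type) [Fintype ι] :
    ∃ X : Matrix ι ι ℝ, X.IsSymm ∧ ∀ T T' : Matrix ι ι ℚ, T.IsSymm → T'.IsSymm →
      eFun (trPair T (X.map ((↑) : ℝ → ℂ))) = eFun (trPair T' (X.map ((↑) : ℝ → ℂ))) →
      T = T' := by
  obtain ⟨y, hy⟩ : ∃ y : Option (ι × ι) → ℝ, LinearIndependent ℚ y := by
    let b := Module.Basis.ofVectorSpace ℚ ℝ
    have : Infinite (Module.Basis.ofVectorSpaceIndex ℚ ℝ) := by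
      rw [Cardinal.infinite_iff, b.mk_eq_rank'', Real.rank_rat_real]
      exact Cardinal.aleph0_le_continuum
    obtain ⟨e⟩ : Nonempty (Option (ι × ι) ↪ Module.Basis.ofVectorSpaceIndex ℚ ℝ) := by
      classical
      exact ⟨(Fintype.equivFin _).toEmbedding.trans
        (Fin.valEmbedding.trans (Infinite.natEmbedding _))⟩
    exact ⟨_, b.linearIndependent.comp e e.injective⟩
  have hy0 : y none ≠ 0 := hy.ne_zero none
  let x : Matrix ι ι ℝ := Matrix.of fun i j => y (some (i, j)) / y none
  refine ⟨x + xᵀ, by simp [Matrix.IsSymm, add_comm], fun T T' hT hT' h => ?_⟩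
  rw [trPair_ofReal, trPair_ofReal, eFun_eq_eFun_iff] at h
  obtain ⟨k, hk⟩ := h
  have hk : (T.map ((↑) : ℚ → ℝ) * (x + xᵀ)).trace =
    (T'.map ((↑) : ℚ → ℝ) * (x + xᵀ)).trace + k := by exact_mod_cast hk
  have htr : ∀ R : Matrix ι ι ℚ, R.IsSymm → (R.map ((↑) : ℚ → ℝ) * (x + xᵀ)).trace =
      2 * (∑ p : ι × ι, (R p.1 p.2 : ℝ) * y (some p)) / y none := by
    intro R hR
    have h1 : (R.map ((↑) : ℚ → ℝ) * x).trace = (R.map ((↑) : ℚ → ℝ) * xᵀ).trace := by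
      rw [← Matrix.trace_transpose, Matrix.transpose_mul, Matrix.trace_mul_comm,
        ← Matrix.transpose_map, hR.eq]
    rw [Matrix.mul_add, Matrix.trace_add, h1, ← two_mul, mul_div_assoc]
    congr 1
    simp only [Matrix.trace, Matrix.diag, Matrix.mul_apply, Fintype.sum_prod_type, Finset.sum_div]
    simp [x, mul_div_assoc]
  rw [htr T hT, htr T' hT', ← sub_eq_iff_eq_add'] at hk
  rw [← sub_div, div_eq_iff hy0, ← mul_sub, ← Finset.sum_sub_distrib] at hk
  have h0 := Fintype.linearIndependent_iff.1 hy
    (fun o => o.elim (-(k : ℚ)) fun p => 2 * (T p.1 p.2 - T' p.1 p.2)) (by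
      simp only [Fintype.sum_option, Option.elim, Rat.smul_def]
      push_cast
      rw [neg_mul, ← hk, Finset.mul_sum, neg_add_eq_zero]
      exact Finset.sum_congr rfl fun p _ => by ring)
  ext i j
  have := h0 (some (i, j))
  simp only [Option.elim] at this
  linarith

end TracePairing

section Holomorphy

variable {E : Type*} [NormedAddCommGroup E] [NormedSpace ℂ E] [FiniteDimensional ℂ E]

lemma exists_finset_norm_le_re_apply :
    ∃ D : Finset E, ∀ l : E →L[ℂ] ℂ, ∃ d ∈ D, ‖l‖ ≤ (l d).re := by
  classical
  let b := Module.finBasis ℂ E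
  obtain ⟨C, hC, hCb⟩ := b.exists_opNorm_le (F := ℂ)
  let s : Finset ℂ := {1, -1, Complex.I, -Complex.I}
  refine ⟨insert 0 ((Finset.univ ×ˢ s).image fun p => ((4 * C : ℝ) : ℂ) • p.2 • b p.1),
    fun l => ?_⟩
  by_contra! h
  have h0 : 0 < ‖l‖ := by simpa using h 0 (Finset.mem_insert_self _ _)
  have hd : ∀ i, ∀ a ∈ s, 4 * C * (a * l (b i)).re < ‖l‖ := by
    intro i a ha
    have := h (((4 * C : ℝ) : ℂ) • a • b i)
      (Finset.mem_insert_of_mem (Finset.mem_image.2 ⟨(i, a), by simp [ha], rfl⟩))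
    simpa only [map_smul, smul_eq_mul, Complex.re_ofReal_mul] using this
  have hb : ∀ i, ‖l (b i)‖ ≤ ‖l‖ / (2 * C) := by
    intro i
    have h1 := hd i 1 (by simp [s])
    have h2 := hd i (-1) (by simp [s])
    have h3 := hd i Complex.I (by simp [s])
    have h4 := hd i (-Complex.I) (by simp [s])
    simp only [one_mul, neg_mul, Complex.neg_re, Complex.I_mul_re] at h1 h2 h3 h4
    have hre : |(l (b i)).re| ≤ ‖l‖ / (4 * C) := by
      rw [abs_le, ← neg_div, div_le_iff₀ (by positivity), le_div_iff₀ (by positivity)]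
      constructor <;> linarith
    have him : |(l (b i)).im| ≤ ‖l‖ / (4 * C) := by
      rw [abs_le, ← neg_div, div_le_iff₀ (by positivity), le_div_iff₀ (by positivity)]
      constructor <;> linarith
    refine (Complex.norm_le_abs_re_add_abs_im _).trans ((add_le_add hre him).trans_eq ?_)
    field_simp; norm_num
  have := hCb (by positivity) hb
  have h2 : C * (‖l‖ / (2 * C)) = ‖l‖ / 2 := by field_simp
  linarith

/-- A pointwise absolutely convergent series of exponentials of linear forms is holomorphic. -/
lemma differentiableOn_tsum_exp {I : Type*} (c : I → ℂ) (l : I → E →L[ℂ] ℂ) {U : Set E}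
    (hU : IsOpen U) (hs : ∀ p ∈ U, Summable fun i => c i * Complex.exp (l i p)) :
    DifferentiableOn ℂ (fun p => ∑' i, c i * Complex.exp (l i p)) U := by
  intro p hp
  obtain ⟨D, hD⟩ := exists_finset_norm_le_re_apply (E := E)
  have hev : ∀ᶠ δ : ℝ in 𝓝[>] 0, ∀ d ∈ D, p + (δ : ℂ) • d ∈ U := by
    rw [Filter.eventually_all_finset]
    intro d _
    have hc : Continuous fun δ : ℝ => p + (δ : ℂ) • d := by fun_prop
    have := hc.continuousAt.eventually_mem (x := 0) (by simpa using hU.mem_nhds hp)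
    exact this.filter_mono nhdsWithin_le_nhds
  obtain ⟨δ, hδU, hδ⟩ := (hev.and self_mem_nhdsWithin).exists
  have hδ : 0 < δ := hδ
  set r : ℝ := δ / 2 with hr
  have hr0 : 0 < r := by positivity
  let f' : I → E → E →L[ℂ] ℂ := fun i q => c i • Complex.exp (l i q) • l i
  let u : I → ℝ := fun i => r⁻¹ * ∑ d ∈ D, ‖c i * Complex.exp (l i (p + (δ : ℂ) • d))‖
  have hu : Summable u :=
    (summable_sum fun d hd => (hs _ (hδU d hd)).norm).mul_left _
  have hder : ∀ i, ∀ q ∈ Metric.ball p r,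
      HasFDerivAt (fun q => c i * Complex.exp (l i q)) (f' i q) q := fun i q _ =>
    ((l i).hasFDerivAt.cexp).const_mul (c i)
  have hbd : ∀ i, ∀ q ∈ Metric.ball p r, ‖f' i q‖ ≤ u i := by
    intro i q hq
    obtain ⟨d, hd, hld⟩ := hD (l i)
    have h1 : (l i q).re ≤ (l i p).re + r * ‖l i‖ := by
      have : (l i q).re - (l i p).re ≤ ‖l i‖ * ‖q - p‖ := by
        rw [← Complex.sub_re, ← map_sub]
        exact (Complex.re_le_norm _).trans ((l i).le_opNorm _)
      have h2 : ‖q - p‖ ≤ r := by rw [← dist_eq_norm]; exact (Metric.mem_ball.1 hq).le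
      nlinarith [norm_nonneg (l i)]
    have h2 : ‖l i‖ ≤ r⁻¹ * Real.exp (r * ‖l i‖) := by
      rw [inv_mul_eq_div, le_div_iff₀ hr0, mul_comm]
      linarith [Real.add_one_le_exp (r * ‖l i‖)]
    have h3 : ‖f' i q‖ ≤ r⁻¹ * ‖c i * Complex.exp (l i (p + (δ : ℂ) • d))‖ := by
      simp only [f', norm_smul, norm_mul, Complex.norm_exp, map_add, map_smul, smul_eq_mul,
        Complex.add_re, Complex.re_ofReal_mul]
      calc ‖c i‖ * (Real.exp (l i q).re * ‖l i‖)
          ≤ ‖c i‖ * (Real.exp ((l i p).re + r * ‖l i‖) * (r⁻¹ * Real.exp (r * ‖l i‖))) := by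
            gcongr
        _ = r⁻¹ * (‖c i‖ * Real.exp ((l i p).re + δ * ‖l i‖)) := by
            have : (l i p).re + δ * ‖l i‖ = (l i p).re + r * ‖l i‖ + r * ‖l i‖ := by
              rw [hr]; ring
            rw [this, Real.exp_add ((l i p).re + r * ‖l i‖)]; ring
        _ ≤ _ := by gcongr
    refine h3.trans ?_
    exact mul_le_mul_of_nonneg_left (Finset.single_le_sum
      (f := fun d => ‖c i * Complex.exp (l i (p + (δ : ℂ) • d))‖) (fun _ _ => norm_nonneg _) hd)
      (by positivity)
  have hpb : p ∈ Metric.ball p r := Metric.mem_ball_self hr0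
  exact (hasFDerivAt_tsum_of_isPreconnected hu Metric.isOpen_ball
    (convex_ball p r).isPreconnected hder hbd hpb (hs p hp)
    hpb).differentiableAt.differentiableWithinAt

end Holomorphy

section Symplectic

variable {ι : Type} [Fintype ι] [DecidableEq ι]

/-- The symplectic transformation law. -/
def IsModular (k : ℤ) (F : Matrix ι ι ℂ → ℂ) : Prop :=
  ∀ g ∈ SpSet ι, ∀ Z ∈ SiegelHalfSpace ι, F (actSp g Z) = jfac g Z ^ k * F Z

variable {k : ℤ} {F : Matrix ι ι ℂ → ℂ}

lemma IsModular.apply_conj (hF : IsModular k F) {U V : Matrix ι ι ℤ} (hUV : V * U = 1)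
    (hV : V.det = 1) {Z : Matrix ι ι ℂ} (hZ : Z ∈ SiegelHalfSpace ι) :
    F (U.map ((↑) : ℤ → ℂ) * Z * (U.map ((↑) : ℤ → ℂ))ᵀ) = F Z := by
  have hg : fromBlocks U 0 0 Vᵀ ∈ SpSet ι := by
    simp [SpSet, Jmat, fromBlocks_transpose, fromBlocks_multiply, ← transpose_mul, hUV]
  have h := hF _ hg Z hZ
  have hUV' : (V.map ((↑) : ℤ → ℂ)) * (U.map ((↑) : ℤ → ℂ)) = 1 := by
    change (Int.castRingHom ℂ).mapMatrix V * (Int.castRingHom ℂ).mapMatrix U = 1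
    rw [← map_mul, hUV, map_one]
  have hV' : (V.map ((↑) : ℤ → ℂ)).det = 1 := by
    have := (Int.castRingHom ℂ).map_det V
    rw [hV, map_one] at this
    exact this.symm
  have hinv : ((V.map ((↑) : ℤ → ℂ))ᵀ)⁻¹ = (U.map ((↑) : ℤ → ℂ))ᵀ := by
    apply Matrix.inv_eq_left_inv
    rw [← transpose_mul, hUV', transpose_one]
  simpa [actSp, jfac, blkA, blkB, blkC, blkD, fromBlocks_map, transpose_map, hinv, hV'] using h

lemma IsModular.apply_add (hF : IsModular k F) {B : Matrix ι ι ℤ} (hB : B.IsSymm)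
    {Z : Matrix ι ι ℂ} (hZ : Z ∈ SiegelHalfSpace ι) : F (Z + B.map ((↑) : ℤ → ℂ)) = F Z := by
  have hg : fromBlocks 1 B 0 1 ∈ SpSet ι := by
    simp [SpSet, Jmat, fromBlocks_transpose, fromBlocks_multiply, hB.eq]
  simpa [actSp, jfac, blkA, blkB, blkC, blkD, fromBlocks_map] using hF _ hg Z hZ

end Symplectic

section BlockPoint

variable {m : ℕ}

/-- The point `(W, u; ᵀu, τ)`. -/
def blockPoint (W : Matrix (Fin m) (Fin m) ℂ) (u : Fin m → ℂ) (τ : ℂ) :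
    Matrix (Fin m ⊕ Unit) (Fin m ⊕ Unit) ℂ :=
  fromBlocks W (replicateCol Unit u) (replicateRow Unit u) (of fun _ _ => τ)

lemma blockPoint_add_smul (W X : Matrix (Fin m) (Fin m) ℂ) (u : Fin m → ℂ) (τ a : ℂ) :
    blockPoint (W + a • X) u τ = blockPoint W u τ + a • blockPoint X 0 0 := by
  ext (i | i) (j | j) <;> simp [blockPoint]

lemma trPair_blockPoint_zero (T : Matrix (Fin m ⊕ Unit) (Fin m ⊕ Unit) ℚ)
    (X : Matrix (Fin m) (Fin m) ℂ) :
    trPair T (blockPoint X 0 0) = trPair T.toBlocks₁₁ X := by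
  simp [trPair, blockPoint, Matrix.trace, Matrix.mul_apply, toBlocks₁₁]

lemma trPair_borderMat {S : Matrix (Fin m) (Fin m) ℚ} (hS : S.IsSymm) (ξ : Fin m → ℚ) (N : ℚ)
    (W : Matrix (Fin m) (Fin m) ℂ) (u : Fin m → ℂ) (τ : ℂ) :
    trPair (borderMat S ξ N) (blockPoint W u τ) =
      trPair S W + (N * τ + 2 * sigmaC S (fun i => (ξ i : ℂ)) u) := by
  have h1 : ∑ i, ((S *ᵥ ξ) i : ℂ) * u i = sigmaC S (fun i => (ξ i : ℂ)) u := by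
    simp only [sigmaC, dotProduct, mulVec, Matrix.map_apply, Finset.mul_sum, Finset.sum_mul,
      Rat.cast_sum, Rat.cast_mul]
    rw [Finset.sum_comm]
    refine Finset.sum_congr rfl fun i _ => Finset.sum_congr rfl fun j _ => ?_
    rw [hS.apply]; ring
  have h2 : ∑ i, ((ξ ᵥ* S) i : ℂ) * u i = sigmaC S (fun i => (ξ i : ℂ)) u := by
    rw [← h1, ← mulVec_transpose, hS.eq]
  simp only [trPair, blockPoint, borderMat, Matrix.trace, Matrix.mul_apply, Fintype.sum_sum_type,
    Matrix.diag, Matrix.map_apply, fromBlocks_apply₁₁, fromBlocks_apply₂₁, fromBlocks_apply₁₂,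
    fromBlocks_apply₂₂, replicateCol_apply, replicateRow_apply, of_apply, Finset.univ_unique,
    Finset.sum_singleton, Finset.sum_add_distrib, h1, h2]
  ring

lemma trPair_vecMulVec (S : Matrix (Fin m) (Fin m) ℚ) (x y : Fin m → ℂ) :
    trPair S (vecMulVec x y) = sigmaC S y x := by
  rw [trPair, Matrix.mul_vecMulVec, Matrix.trace_vecMulVec, dotProduct_comm, sigmaC]

lemma sigmaC_comm {S : Matrix (Fin m) (Fin m) ℚ} (hS : S.IsSymm) (x y : Fin m → ℂ) :
    sigmaC S x y = sigmaC S y x := by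
  rw [sigmaC, sigmaC, dotProduct_mulVec, dotProduct_comm, ← mulVec_transpose, ← transpose_map,
    hS.eq]

lemma posDef_fromBlocks_of_lt {Q : Matrix (Fin m) (Fin m) ℝ} (hQ : Q.IsSymm) (v : Fin m → ℝ)
    {t : ℝ} (ht : 0 < t) {y : ℝ} (hy : ∑ i, ∑ j, |Q i j| + (∑ i, v i ^ 2) / t < y) :
    (fromBlocks (Q + y • 1) (replicateCol Unit v) (replicateRow Unit v)
      (of fun _ _ => t)).PosDef := by
  refine PosDef.of_dotProduct_mulVec_pos ?_ fun x hx => ?_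
  · rw [Matrix.IsHermitian, conjTranspose_eq_transpose_of_trivial]
    ext (i | i) (j | j) <;> simp [hQ.apply, Matrix.one_apply, eq_comm]
  · obtain ⟨a, s, rfl⟩ : ∃ (a : Fin m → ℝ) (s : ℝ), x = Sum.elim a fun _ => s :=
      ⟨x ∘ Sum.inl, x (Sum.inr ()), by ext (i | i) <;> rfl⟩
    have hform : star (Sum.elim a fun _ : Unit => s) ⬝ᵥ
        (fromBlocks (Q + y • 1) (replicateCol Unit v) (replicateRow Unit v)
          (of fun _ _ => t)) *ᵥ (Sum.elim a fun _ => s) =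
        (∑ i, ∑ j, a i * (Q i j * a j)) + y * (∑ i, a i ^ 2) + 2 * s * (∑ i, v i * a i)
          + t * s ^ 2 := by
      set M := fromBlocks (Q + y • 1) (replicateCol Unit v) (replicateRow Unit v)
        (of fun _ _ => t) with hM
      have hl : ∀ i, (M *ᵥ (Sum.elim a fun _ => s)) (Sum.inl i) =
          ∑ j, Q i j * a j + y * a i + v i * s := fun i => by
        simp [hM, mulVec, dotProduct, add_mul, Finset.sum_add_distrib, Matrix.one_apply]
      have hr : (M *ᵥ (Sum.elim a fun _ => s)) (Sum.inr ()) = ∑ j, v j * a j + t * s := by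
        simp [hM, mulVec, dotProduct]
      have hp : ∑ i, a i * (v i * s) = s * ∑ i, v i * a i := by
        rw [Finset.mul_sum]
        exact Finset.sum_congr rfl fun i _ => by ring
      have hy : ∑ i, a i * (y * a i) = y * ∑ i, a i ^ 2 := by
        rw [Finset.mul_sum]
        exact Finset.sum_congr rfl fun i _ => by ring
      have hq : ∑ i, ∑ j, a i * (Q i j * a j) = ∑ i, a i * ∑ j, Q i j * a j := by
        simp only [Finset.mul_sum]
      simp only [star_trivial, dotProduct, Fintype.sum_sum_type, hl, hr, Sum.elim_inl, Sum.elim_inr,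
        Finset.univ_unique, Finset.sum_singleton, mul_add, Finset.sum_add_distrib, hp, hy,
        PUnit.default_eq_unit, hq]
      ring
    rw [hform]
    have hQa : -((∑ i, ∑ j, |Q i j|) * ∑ l, a l ^ 2) ≤ ∑ i, ∑ j, a i * (Q i j * a j) := by
      rw [Finset.sum_mul, ← Finset.sum_neg_distrib]
      refine Finset.sum_le_sum fun i _ => ?_
      rw [Finset.sum_mul, ← Finset.sum_neg_distrib]
      refine Finset.sum_le_sum fun j _ => ?_
      have hle : ∀ i, a i ^ 2 ≤ ∑ l, a l ^ 2 := fun i =>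
        Finset.single_le_sum (f := fun l => a l ^ 2) (fun _ _ => sq_nonneg _) (Finset.mem_univ i)
      have h1 : |a i * a j| ≤ ∑ l, a l ^ 2 := by
        rw [abs_mul]
        nlinarith [hle i, hle j, sq_nonneg (|a i| - |a j|), sq_abs (a i), sq_abs (a j)]
      calc -(|Q i j| * ∑ l, a l ^ 2) ≤ -(|Q i j| * |a i * a j|) := by gcongr
        _ = -|a i * (Q i j * a j)| := by rw [← abs_mul]; congr 2; ring
        _ ≤ _ := neg_abs_le _
    have hcs : (∑ i, v i * a i) ^ 2 ≤ (∑ i, v i ^ 2) * ∑ i, a i ^ 2 :=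
      Finset.sum_mul_sq_le_sq_mul_sq _ _ _
    have ha0 : 0 ≤ ∑ i, a i ^ 2 := Finset.sum_nonneg fun _ _ => sq_nonneg _
    set q := ∑ i, ∑ j, |Q i j|
    set A := ∑ i, a i ^ 2
    set V := ∑ i, v i ^ 2
    set p := ∑ i, v i * a i
    rcases ha0.eq_or_lt with h | h
    · have hp : p = 0 := by
        have : p ^ 2 ≤ 0 := by rw [← h, mul_zero] at hcs; exact hcs
        exact pow_eq_zero_iff two_ne_zero |>.1 (le_antisymm this (sq_nonneg _))
      have hs : s ≠ 0 := by
        rintro rfl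
        refine hx ?_
        have h0 := (Finset.sum_eq_zero_iff_of_nonneg fun i _ => sq_nonneg (a i)).1 h.symm
        ext (i | i)
        · simpa using h0 i (Finset.mem_univ i)
        · rfl
      rw [← h] at hQa
      rw [hp, ← h]
      have : 0 < t * s ^ 2 := by positivity
      linarith
    · have h2 : t * (q + V / t) < t * y := by gcongr
      have h3 : t * (q + V / t) = t * q + V := by field_simp
      rw [h3] at h2
      refine pos_of_mul_pos_right (a := t) ?_ ht.le
      nlinarith [mul_lt_mul_of_pos_right h2 h, mul_le_mul_of_nonneg_left hQa ht.le,
        sq_nonneg (t * s + p)]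

lemma blockPoint_add_mem {W : Matrix (Fin m) (Fin m) ℂ} {u : Fin m → ℂ} {τ : ℂ}
    (h : blockPoint W u τ ∈ SiegelHalfSpace (Fin m ⊕ Unit)) {X : Matrix (Fin m) (Fin m) ℝ}
    (hX : X.IsSymm) :
    blockPoint (W + X.map ((↑) : ℝ → ℂ)) u τ ∈ SiegelHalfSpace (Fin m ⊕ Unit) := by
  refine ⟨?_, ?_⟩
  · have h1 : blockPoint (W + X.map ((↑) : ℝ → ℂ)) u τ =
        blockPoint W u τ + blockPoint (X.map ((↑) : ℝ → ℂ)) 0 0 := by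
      simpa using blockPoint_add_smul W (X.map ((↑) : ℝ → ℂ)) u τ 1
    rw [h1]
    refine h.1.add ?_
    ext (i | i) (j | j) <;> simp [blockPoint, hX.apply]
  · convert h.2 using 1
    ext (i | i) (j | j) <;> simp [blockPoint]

lemma eventually_blockPoint_mem {W : Matrix (Fin m) (Fin m) ℂ} (hW : W.IsSymm) (u : Fin m → ℂ)
    {τ : ℂ} (hτ : 0 < τ.im) :
    ∀ᶠ y : ℝ in atTop, blockPoint (W + ((y : ℂ) * Complex.I) • 1) u τ ∈
      SiegelHalfSpace (Fin m ⊕ Unit) := by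
  have hQ : (W.map Complex.im).IsSymm := by
    rw [Matrix.IsSymm, ← transpose_map, hW.eq]
  filter_upwards [eventually_gt_atTop _] with y hy
  refine ⟨?_, ?_⟩
  · ext (i | i) (j | j) <;> simp [blockPoint, hW.apply, Matrix.one_apply, eq_comm]
  · convert posDef_fromBlocks_of_lt hQ (fun i => (u i).im) hτ hy using 1
    ext (i | i) (j | j) <;> simp [blockPoint, Matrix.one_apply]
    split_ifs <;> simp

end BlockPoint

section FourierSeries

/-- `F` is the sum of the Fourier series with coefficients `A` on the Siegel half space. -/
def HasFourierSeries {ι : Type} [Fintype ι] [DecidableEq ι] (F : Matrix ι ι ℂ → ℂ)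
    (A : Matrix ι ι ℚ → ℂ) : Prop :=
  (∀ T, ¬ IsHalfIntegral T → A T = 0) ∧
    ∀ Z ∈ SiegelHalfSpace ι, HasSum (fun T => A T * eFun (trPair T Z)) (F Z)

lemma map_ofReal_smul {ι : Type} (X : Matrix ι ι ℝ) (j : ℕ) :
    ((j : ℝ) • X).map ((↑) : ℝ → ℂ) = (j : ℂ) • X.map ((↑) : ℝ → ℂ) := by
  ext; simp

lemma trPair_add_smul {ι : Type} [Fintype ι] (T : Matrix ι ι ℚ) (Z X : Matrix ι ι ℂ) (j : ℕ) :
    eFun (trPair T (Z + (j : ℂ) • X)) = eFun (trPair T Z) * eFun (trPair T X) ^ j := by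
  rw [trPair_add, trPair_smul, eFun_add, eFun_natCast_mul]

lemma norm_eFun_trPair_ofReal {ι : Type} [Fintype ι] (T : Matrix ι ι ℚ) (X : Matrix ι ι ℝ) :
    ‖eFun (trPair T (X.map ((↑) : ℝ → ℂ)))‖ = 1 := by
  rw [trPair_ofReal, norm_eFun_ofReal]

variable {m : ℕ} {F : Matrix (Fin m ⊕ Unit) (Fin m ⊕ Unit) ℂ → ℂ}
  {A : Matrix (Fin m ⊕ Unit) (Fin m ⊕ Unit) ℚ → ℂ} {S : Matrix (Fin m) (Fin m) ℚ}

lemma PosDefQ.isUnit_det (h : PosDefQ S) : IsUnit S.det := by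
  have h1 := (Matrix.isUnit_iff_isUnit_det _).1 (PosDef.isUnit h)
  have h2 : (S.map fun q => (q : ℝ)).det = ((S.det : ℚ) : ℝ) :=
    ((Rat.castHom ℝ).map_det S).symm
  rw [h2] at h1
  simpa using h1

lemma borderMat_injective (h : PosDefQ S) :
    Function.Injective fun p : ℤ × (Fin m → ℚ) => borderMat S p.2 (p.1 : ℚ) := by
  rintro ⟨N, ξ⟩ ⟨N', ξ'⟩ he
  have h1 : (N : ℚ) = N' := congrFun₂ he (Sum.inr ()) (Sum.inr ())
  have h2 : S *ᵥ ξ = S *ᵥ ξ' := funext fun i => congrFun₂ he (Sum.inl i) (Sum.inr ())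
  have h3 : ξ = ξ' := Matrix.mulVec_injective_of_isUnit
    ((Matrix.isUnit_iff_isUnit_det _).2 h.isUnit_det) h2
  rw [Int.cast_inj.1 h1, h3]

lemma exists_borderMat_eq (h : PosDefQ S) {T : Matrix (Fin m ⊕ Unit) (Fin m ⊕ Unit) ℚ}
    (hT : IsHalfIntegral T) (hTS : T.toBlocks₁₁ = S) :
    ∃ p : ℤ × (Fin m → ℚ), borderMat S p.2 (p.1 : ℚ) = T := by
  obtain ⟨N, hN⟩ := hT.2.1 (Sum.inr ())
  have hS : Sᵀ = S := by
    ext i j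
    rw [← hTS]
    exact hT.1.apply _ _
  have hr : S *ᵥ (S⁻¹ *ᵥ fun i => T (Sum.inl i) (Sum.inr ())) =
      fun i => T (Sum.inl i) (Sum.inr ()) := by
    rw [mulVec_mulVec, Matrix.mul_nonsing_inv _ h.isUnit_det, one_mulVec]
  refine ⟨(N, S⁻¹ *ᵥ fun i => T (Sum.inl i) (Sum.inr ())), ?_⟩
  ext (i | i) (j | j)
  · exact congrFun₂ hTS.symm i j
  · exact congrFun hr i
  · rw [← hT.1.apply]
    change ((S⁻¹ *ᵥ fun i => T (Sum.inl i) (Sum.inr ())) ᵥ* S) j = _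
    rw [← mulVec_transpose, hS, hr]
  · exact hN.symm

lemma HasFourierSeries.tsum_corner (hA : HasFourierSeries F A) (hS : S.IsSymm) (hpd : PosDefQ S)
    {X : Matrix (Fin m) (Fin m) ℝ}
    (hX : ∀ T T' : Matrix (Fin m) (Fin m) ℚ, T.IsSymm → T'.IsSymm →
      eFun (trPair T (X.map ((↑) : ℝ → ℂ))) = eFun (trPair T' (X.map ((↑) : ℝ → ℂ))) → T = T')
    (W : Matrix (Fin m) (Fin m) ℂ) (u : Fin m → ℂ) (τ : ℂ) :
    (∑' T, if eFun (trPair T.toBlocks₁₁ (X.map ((↑) : ℝ → ℂ))) =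
        eFun (trPair S (X.map ((↑) : ℝ → ℂ))) then A T * eFun (trPair T (blockPoint W u τ))
      else 0) = eFun (trPair S W) * fjCoeff A S (τ, u) := by
  rw [← (borderMat_injective hpd).tsum_eq, fjCoeff, ← tsum_mul_left]
  · refine tsum_congr fun p => ?_
    rw [if_pos (by rfl), trPair_borderMat hS, eFun_add]
    push_cast
    ring
  · intro T hT
    rw [Function.mem_support] at hT
    split_ifs at hT with h
    · have hT' : IsHalfIntegral T := by
        by_contra hn
        simp [hA.1 T hn] at hT
      have hsym : T.toBlocks₁₁.IsSymm := by
        ext i j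
        exact hT'.1.apply _ _
      exact exists_borderMat_eq hpd hT' (hX _ _ hsym hS h)
    · exact absurd rfl hT

/-- A functional equation of `F` that is uniform in the real part of `W` passes to the
Fourier–Jacobi coefficients. -/
lemma HasFourierSeries.fjCoeff_eq (hA : HasFourierSeries F A) (hS : S.IsSymm) (hpd : PosDefQ S)
    {W W' : Matrix (Fin m) (Fin m) ℂ} {u u' : Fin m → ℂ} {τ τ' μ : ℂ}
    (hZ : blockPoint W u τ ∈ SiegelHalfSpace (Fin m ⊕ Unit))
    (hZ' : blockPoint W' u' τ' ∈ SiegelHalfSpace (Fin m ⊕ Unit))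
    (h : ∀ X : Matrix (Fin m) (Fin m) ℝ, X.IsSymm →
      F (blockPoint (W' + X.map ((↑) : ℝ → ℂ)) u' τ') =
        μ * F (blockPoint (W + X.map ((↑) : ℝ → ℂ)) u τ)) :
    eFun (trPair S W') * fjCoeff A S (τ', u') =
      μ * (eFun (trPair S W) * fjCoeff A S (τ, u)) := by
  obtain ⟨X, hXs, hX⟩ := exists_separating_matrix (Fin m)
  have hexp : ∀ {W : Matrix (Fin m) (Fin m) ℂ} {u : Fin m → ℂ} {τ : ℂ},
      blockPoint W u τ ∈ SiegelHalfSpace (Fin m ⊕ Unit) → ∀ j : ℕ,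
      F (blockPoint (W + ((j : ℝ) • X).map ((↑) : ℝ → ℂ)) u τ) =
        ∑' T, A T * eFun (trPair T (blockPoint W u τ)) *
          eFun (trPair T.toBlocks₁₁ (X.map ((↑) : ℝ → ℂ))) ^ j := by
    intro W u τ hW j
    rw [← (hA.2 _ (blockPoint_add_mem hW (hXs.smul (j : ℝ)))).tsum_eq]
    refine tsum_congr fun T => ?_
    rw [map_ofReal_smul, blockPoint_add_smul, trPair_add_smul, trPair_blockPoint_zero, mul_assoc]
  rw [← hA.tsum_corner hS hpd hX, ← hA.tsum_corner hS hpd hX, ← tsum_mul_left]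
  simp_rw [mul_ite, mul_zero]
  refine tsum_ite_eq_of_forall_pow (hA.2 _ hZ').summable (fun _ => norm_eFun_trPair_ofReal _ _)
    ((hA.2 _ hZ).summable.mul_left μ) (fun _ => norm_eFun_trPair_ofReal _ _) (fun j => ?_)
    (norm_eFun_trPair_ofReal _ _)
  rw [← hexp hZ', h _ (hXs.smul (j : ℝ)), hexp hZ, ← tsum_mul_left]
  exact tsum_congr fun T => by ring

lemma HasFourierSeries.summable_fjCoeff (hA : HasFourierSeries F A) (hS : S.IsSymm)
    (hpd : PosDefQ S) {τ : ℂ} (hτ : 0 < τ.im) (u : Fin m → ℂ) :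
    Summable fun p : ℤ × (Fin m → ℚ) => A (borderMat S p.2 (p.1 : ℚ)) *
      eFun ((p.1 : ℂ) * τ + 2 * sigmaC S (fun i => (p.2 i : ℂ)) u) := by
  obtain ⟨y, hy⟩ := (eventually_blockPoint_mem (W := 0) (by simp [Matrix.IsSymm]) u hτ).exists
  refine (((hA.2 _ hy).summable.comp_injective (borderMat_injective hpd)).mul_left
    (eFun (trPair S (0 + ((y : ℂ) * Complex.I) • 1)))⁻¹).congr fun p => ?_
  rw [Function.comp_apply, trPair_borderMat hS, eFun_add]
  push_cast
  field_simp [eFun_ne_zero]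

lemma HasFourierSeries.differentiableOn_fjCoeff (hA : HasFourierSeries F A) (hS : S.IsSymm)
    (hpd : PosDefQ S) : DifferentiableOn ℂ (fjCoeff A S) {p | 0 < p.1.im} := by
  let s : (Fin m → ℚ) → (Fin m → ℂ) →ₗ[ℂ] ℂ := fun ξ =>
    { toFun := sigmaC S (fun i => (ξ i : ℂ))
      map_add' := fun x y => by simp [sigmaC, mulVec_add]
      map_smul' := fun a x => by simp [sigmaC, mulVec_smul] }
  let l : ℤ × (Fin m → ℚ) → (ℂ × (Fin m → ℂ)) →L[ℂ] ℂ := fun p =>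
    (2 * Real.pi * Complex.I : ℂ) • ((p.1 : ℂ) • ContinuousLinearMap.fst ℂ ℂ (Fin m → ℂ) +
      (2 : ℂ) • (s p.2).toContinuousLinearMap.comp (ContinuousLinearMap.snd ℂ ℂ (Fin m → ℂ)))
  have hl : ∀ p q, Complex.exp (l p q) =
      eFun ((p.1 : ℂ) * q.1 + 2 * sigmaC S (fun i => (p.2 i : ℂ)) q.2) := fun p q => rfl
  have h := differentiableOn_tsum_exp (fun p : ℤ × (Fin m → ℚ) => A (borderMat S p.2 (p.1 : ℚ))) l
    (U := {p | 0 < p.1.im})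
    (isOpen_lt continuous_const (Complex.continuous_im.comp continuous_fst)) (fun p hp => by
      simpa only [hl] using hA.summable_fjCoeff hS hpd hp p.2)
  simp only [hl] at h
  exact h

end FourierSeries

section Koecher

variable {ι : Type} [Fintype ι]

lemma trPair_conj (T : Matrix ι ι ℚ) (U : Matrix ι ι ℤ) (Z : Matrix ι ι ℂ) :
    trPair T (U.map ((↑) : ℤ → ℂ) * Z * (U.map ((↑) : ℤ → ℂ))ᵀ) =
      trPair ((U.map ((↑) : ℤ → ℚ))ᵀ * T * U.map ((↑) : ℤ → ℚ)) Z := by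
  have h : ((U.map ((↑) : ℤ → ℚ))ᵀ * T * U.map ((↑) : ℤ → ℚ)).map (fun q => (q : ℂ)) =
      (U.map ((↑) : ℤ → ℂ))ᵀ * T.map (fun q => (q : ℂ)) * U.map ((↑) : ℤ → ℂ) := by
    ext i j
    simp [Matrix.mul_apply]
  rw [trPair, trPair, h, ← Matrix.mul_assoc, Matrix.trace_mul_comm]
  simp only [Matrix.mul_assoc]

lemma exists_int_dotProduct_neg {T : Matrix ι ι ℚ} (hT : T.IsSymm) (hneg : ¬ PosSemidefQ T) :
    ∃ v : ι → ℤ, (fun i => (v i : ℚ)) ⬝ᵥ T *ᵥ (fun i => (v i : ℚ)) < 0 := by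
  obtain ⟨x, hx⟩ : ∃ x : ι → ℝ, x ⬝ᵥ (T.map fun q => (q : ℝ)) *ᵥ x < 0 := by
    by_contra! h
    refine hneg (PosSemidef.of_dotProduct_mulVec_nonneg ?_ fun x => by simpa using h x)
    rw [Matrix.IsHermitian, conjTranspose_eq_transpose_of_trivial, ← transpose_map, hT.eq]
  have hd : DenseRange fun (r : ι → ℚ) (i : ι) => (r i : ℝ) :=
    DenseRange.piMap fun _ => Rat.denseRange_cast
  have ho : IsOpen {x : ι → ℝ | x ⬝ᵥ (T.map fun q => (q : ℝ)) *ᵥ x < 0} := by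
    refine isOpen_lt ?_ continuous_const
    simp only [dotProduct, mulVec]
    fun_prop
  obtain ⟨r, hr⟩ := hd.exists_mem_open ho ⟨x, hx⟩
  have hr' : r ⬝ᵥ T *ᵥ r < 0 := by
    have : ((r ⬝ᵥ T *ᵥ r : ℚ) : ℝ) < 0 := by
      simpa [dotProduct, mulVec] using hr
    exact_mod_cast this
  have hden : ∀ i, ∃ z : ℤ, ((∏ j, (r j).den : ℕ) : ℚ) * r i = z := by
    intro i
    obtain ⟨e, he⟩ := Finset.dvd_prod_of_mem (fun j => (r j).den) (Finset.mem_univ i)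
    refine ⟨e * (r i).num, ?_⟩
    rw [he]
    push_cast
    rw [mul_right_comm, mul_comm ((r i).den : ℚ), Rat.mul_den_eq_num, mul_comm]
  choose v hv using hden
  refine ⟨v, ?_⟩
  have hv' : (fun i => (v i : ℚ)) = ((∏ j, (r j).den : ℕ) : ℚ) • r := by
    ext i; simp [← hv i]
  have hpos : (0 : ℚ) < ((∏ j, (r j).den : ℕ) : ℚ) := by
    exact_mod_cast Finset.prod_pos fun j _ => (r j).den_pos
  rw [hv', mulVec_smul, smul_dotProduct, dotProduct_smul, smul_eq_mul, smul_eq_mul]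
  exact mul_neg_of_pos_of_neg hpos (mul_neg_of_pos_of_neg hpos hr')

variable [DecidableEq ι] {k : ℤ} {F : Matrix ι ι ℂ → ℂ} {A : Matrix ι ι ℚ → ℂ}

lemma conj_mem_siegelHalfSpace {U V : Matrix ι ι ℤ} (hUV : V * U = 1) {Z : Matrix ι ι ℂ}
    (hZ : Z ∈ SiegelHalfSpace ι) :
    U.map ((↑) : ℤ → ℂ) * Z * (U.map ((↑) : ℤ → ℂ))ᵀ ∈ SiegelHalfSpace ι := by
  refine ⟨?_, ?_⟩
  · rw [Matrix.IsSymm, transpose_mul, transpose_mul, transpose_transpose, hZ.1.eq, Matrix.mul_assoc]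
  · have him : (U.map ((↑) : ℤ → ℂ) * Z * (U.map ((↑) : ℤ → ℂ))ᵀ).map Complex.im =
        U.map ((↑) : ℤ → ℝ) * Z.map Complex.im * (U.map ((↑) : ℤ → ℝ))ᴴ := by
      ext i j
      simp [Matrix.mul_apply, Finset.sum_mul]
    rw [him]
    refine hZ.2.mul_mul_conjTranspose_same (Matrix.vecMul_injective_of_isUnit ?_)
    refine IsUnit.of_mul_eq_one_right (V.map ((↑) : ℤ → ℝ)) ?_
    change (Int.castRingHom ℝ).mapMatrix V * (Int.castRingHom ℝ).mapMatrix U = 1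
    rw [← map_mul, hUV, map_one]

lemma I_smul_one_mem_siegelHalfSpace (X : Matrix ι ι ℝ) (hX : X.IsSymm) :
    Complex.I • (1 : Matrix ι ι ℂ) + X.map ((↑) : ℝ → ℂ) ∈ SiegelHalfSpace ι := by
  refine ⟨?_, ?_⟩
  · ext i j
    simp [hX.apply, Matrix.one_apply, eq_comm]
  · convert PosDef.one (n := ι) (R := ℝ) using 1
    ext i j
    simp only [Matrix.map_apply, Matrix.add_apply, Matrix.smul_apply, Matrix.one_apply]
    split_ifs <;> simp

/-- Fourier coefficients of modular forms are class functions. -/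
lemma HasFourierSeries.coeff_conj (hA : HasFourierSeries F A) (hF : IsModular k F)
    {U V : Matrix ι ι ℤ} (hUV : V * U = 1) (hV : V.det = 1) {T : Matrix ι ι ℚ} (hT : T.IsSymm) :
    A ((U.map ((↑) : ℤ → ℚ))ᵀ * T * U.map ((↑) : ℤ → ℚ)) = A T := by
  obtain ⟨X, hXs, hX⟩ := exists_separating_matrix ι
  let conj : Matrix ι ι ℚ → Matrix ι ι ℚ := fun R =>
    (U.map ((↑) : ℤ → ℚ))ᵀ * R * U.map ((↑) : ℤ → ℚ)
  change A (conj T) = A T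
  have hUV' : (V.map ((↑) : ℤ → ℚ)) * (U.map ((↑) : ℤ → ℚ)) = 1 := by
    change (Int.castRingHom ℚ).mapMatrix V * (Int.castRingHom ℚ).mapMatrix U = 1
    rw [← map_mul, hUV, map_one]
  have hVU' := mul_eq_one_comm.1 hUV'
  have hinj : Function.Injective conj := by
    refine Function.LeftInverse.injective
      (g := fun R => (V.map ((↑) : ℤ → ℚ))ᵀ * R * V.map ((↑) : ℤ → ℚ)) fun R => ?_
    calc _ = ((U.map ((↑) : ℤ → ℚ)) * (V.map ((↑) : ℤ → ℚ)))ᵀ * R *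
          ((U.map ((↑) : ℤ → ℚ)) * (V.map ((↑) : ℤ → ℚ))) := by
            simp only [conj, transpose_mul, Matrix.mul_assoc]
      _ = R := by rw [hVU']; simp
  have hsym : ∀ R : Matrix ι ι ℚ, R.IsSymm → (conj R).IsSymm := fun R hR => by
    simp only [conj, Matrix.IsSymm, transpose_mul, transpose_transpose, hR.eq, Matrix.mul_assoc]
  have hA0 : ∀ R, ¬ R.IsSymm → A R = 0 := fun R hR => hA.1 R fun h => hR h.1
  let Z : ℕ → Matrix ι ι ℂ := fun j => Complex.I • 1 + (j : ℂ) • X.map ((↑) : ℝ → ℂ)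
  have hZ : ∀ j, Z j ∈ SiegelHalfSpace ι := fun j => by
    simpa only [map_ofReal_smul] using I_smul_one_mem_siegelHalfSpace _ (hXs.smul (j : ℝ))
  have hI : Complex.I • (1 : Matrix ι ι ℂ) ∈ SiegelHalfSpace ι := by
    simpa [Z] using hZ 0
  have hs := (hA.2 _ (conj_mem_siegelHalfSpace hUV hI)).summable
  simp only [trPair_conj] at hs
  have key := tsum_ite_eq_of_forall_pow (c := fun R => A R * eFun (trPair (conj R) (Complex.I • 1)))
    (z := fun R => eFun (trPair (conj R) (X.map ((↑) : ℝ → ℂ))))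
    (c' := fun R => A R * eFun (trPair R (Complex.I • 1)))
    (z' := fun R => eFun (trPair R (X.map ((↑) : ℝ → ℂ))))
    hs (fun _ => norm_eFun_trPair_ofReal _ _) (hA.2 _ hI).summable
    (fun _ => norm_eFun_trPair_ofReal _ _) (fun j => by
      have h1 := (hA.2 _ (conj_mem_siegelHalfSpace hUV (hZ j))).tsum_eq
      have h2 := (hA.2 _ (hZ j)).tsum_eq
      rw [hF.apply_conj hUV hV (hZ j), ← h2] at h1
      simp only [trPair_conj, Z, trPair_add_smul, ← mul_assoc] at h1
      exact h1) (w := eFun (trPair (conj T) (X.map ((↑) : ℝ → ℂ)))) (norm_eFun_trPair_ofReal _ _)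
  rw [tsum_eq_single T, tsum_eq_single (conj T), if_pos rfl, if_pos rfl] at key
  · exact (mul_right_cancel₀ (eFun_ne_zero _) key).symm
  · intro R hR
    by_cases h : R.IsSymm
    · rw [if_neg fun he => hR (hX _ _ h (hsym _ hT) he)]
    · simp [hA0 R h]
  · intro R hR
    by_cases h : R.IsSymm
    · rw [if_neg fun he => hR (hinj (hX _ _ (hsym _ h) (hsym _ hT) he))]
    · simp [hA0 R h]

lemma exists_int_orthogonal [Nontrivial ι] (v : ι → ℤ) : ∃ w : ι → ℤ, w ≠ 0 ∧ w ⬝ᵥ v = 0 := by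
  obtain ⟨a, b, hab⟩ := exists_pair_ne ι
  by_cases hb : v b = 0
  · exact ⟨Pi.single b 1, by simp, by simp [hb]⟩
  · refine ⟨Pi.single a (v b) - Pi.single b (v a), fun h => hb ?_, ?_⟩
    · simpa [hab] using congrFun h a
    · rw [sub_dotProduct, single_dotProduct, single_dotProduct]; ring

lemma HasFourierSeries.coeff_transvection (hA : HasFourierSeries F A) (hF : IsModular k F)
    {v w : ι → ℤ} (hwv : w ⬝ᵥ v = 0) {T : Matrix ι ι ℚ} (hT : T.IsSymm) :
    A ((1 + vecMulVec (fun i => (v i : ℚ)) (fun i => (w i : ℚ)))ᵀ * T *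
      (1 + vecMulVec (fun i => (v i : ℚ)) (fun i => (w i : ℚ)))) = A T := by
  have hN : vecMulVec v w * vecMulVec v w = 0 := by
    rw [vecMulVec_mul_vecMulVec, hwv]; simp
  have hVU : (1 - vecMulVec v w) * (1 + vecMulVec v w) = 1 := by
    rw [sub_mul, mul_add, mul_add, hN]; simp
  have hdet : (1 - vecMulVec v w).det = 1 := by
    have : 1 - vecMulVec v w = 1 + replicateCol Unit (-v) * replicateRow Unit w := by
      rw [← vecMulVec_eq, neg_vecMulVec, sub_eq_add_neg]
    rw [this, det_one_add_replicateCol_mul_replicateRow]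
    simp [hwv]
  have hU : (1 + vecMulVec v w).map ((↑) : ℤ → ℚ) =
      1 + vecMulVec (fun i => (v i : ℚ)) (fun i => (w i : ℚ)) := by
    ext i j
    simp [vecMulVec_apply, Matrix.one_apply]
  rw [← hU]
  exact hA.coeff_conj hF hVU hdet hT

lemma trace_transvection_conj {T : Matrix ι ι ℚ} (hT : T.IsSymm) (v w : ι → ℚ) :
    ((1 + vecMulVec v w)ᵀ * T * (1 + vecMulVec v w)).trace =
      T.trace + 2 * (w ⬝ᵥ T *ᵥ v) + (v ⬝ᵥ T *ᵥ v) * (w ⬝ᵥ w) := by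
  have hT2 : v ᵥ* T = T *ᵥ v := by rw [← mulVec_transpose, hT.eq]
  simp only [transpose_add, transpose_one, transpose_vecMulVec, Matrix.add_mul, Matrix.mul_add,
    Matrix.one_mul, Matrix.mul_one, trace_add, Matrix.mul_vecMulVec, Matrix.vecMulVec_mul,
    trace_vecMulVec, hT2, add_mulVec, vecMulVec_mulVec, add_dotProduct]
  rw [op_smul_eq_smul, smul_dotProduct, smul_eq_mul, dotProduct_comm (T *ᵥ v) w,
    dotProduct_comm (T *ᵥ v) v]
  ring

/-- Koecher's principle. -/
lemma HasFourierSeries.posSemidef_of_coeff_ne_zero [Nontrivial ι] (hA : HasFourierSeries F A)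
    (hF : IsModular k F) {T : Matrix ι ι ℚ} (hT : A T ≠ 0) : PosSemidefQ T := by
  by_contra hneg
  have hsym : T.IsSymm := by
    by_contra h
    exact hT (hA.1 T fun h' => h h'.1)
  obtain ⟨v, hv⟩ := exists_int_dotProduct_neg hsym hneg
  obtain ⟨w, hw0, hwv⟩ := exists_int_orthogonal v
  let vq : ι → ℚ := fun i => v i
  let wq : ι → ℚ := fun i => w i
  have hww : 0 < wq ⬝ᵥ wq := by
    have h1 : wq ≠ 0 := fun h => hw0 (funext fun i => by simpa [wq] using congrFun h i)
    have h2 : 0 ≤ wq ⬝ᵥ wq := Finset.sum_nonneg fun i _ => mul_self_nonneg (wq i)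
    exact lt_of_le_of_ne h2 fun h => h1 (dotProduct_self_eq_zero.1 h.symm)
  have hcoeff : ∀ h : ℕ, ∃ R : Matrix ι ι ℚ, A R = A T ∧
      R.trace = T.trace + 2 * (wq ⬝ᵥ T *ᵥ vq) * h + (vq ⬝ᵥ T *ᵥ vq) * (wq ⬝ᵥ wq) * h ^ 2 := by
    intro h
    have hhv : w ⬝ᵥ (fun i => (h : ℤ) * v i) = 0 := by
      rw [show (fun i => (h : ℤ) * v i) = (h : ℤ) • v from rfl, dotProduct_smul, hwv, smul_zero]
    refine ⟨_, hA.coeff_transvection hF hhv hsym, ?_⟩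
    have hvq : (fun i => (((h : ℤ) * v i : ℤ) : ℚ)) = (h : ℚ) • vq := by
      ext i; simp [vq]
    rw [trace_transvection_conj hsym, hvq, mulVec_smul, dotProduct_smul, dotProduct_smul,
      smul_dotProduct, smul_eq_mul, smul_eq_mul, smul_eq_mul]
    ring
  have hI : Complex.I • (1 : Matrix ι ι ℂ) ∈ SiegelHalfSpace ι := by
    simpa using I_smul_one_mem_siegelHalfSpace (0 : Matrix ι ι ℝ) (by simp [Matrix.IsSymm])
  have hsum := (hA.2 _ hI).summable.norm
  have hterm : ∀ R : Matrix ι ι ℚ, ‖A R * eFun (trPair R (Complex.I • 1))‖ =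
      ‖A R‖ * Real.exp (-(2 * Real.pi * (R.trace : ℝ))) := by
    intro R
    have : trPair R (Complex.I • 1) = Complex.I * ((R.trace : ℝ) : ℂ) := by
      simp [trPair, Matrix.trace, Finset.mul_sum]
    rw [norm_mul, norm_eFun, this, Complex.I_mul_im, Complex.ofReal_re]
  set K := ∑' R, ‖A R * eFun (trPair R (Complex.I • 1))‖
  have hT0 : 0 < ‖A T‖ := norm_pos_iff.2 hT
  have hbound : ∀ h : ℕ, -(2 * Real.pi * ((T.trace + 2 * (wq ⬝ᵥ T *ᵥ vq) * h +
      (vq ⬝ᵥ T *ᵥ vq) * (wq ⬝ᵥ wq) * h ^ 2 : ℚ) : ℝ)) ≤ K / ‖A T‖ := by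
    intro h
    obtain ⟨R, hR, htr⟩ := hcoeff h
    have h1 := hsum.le_tsum R fun _ _ => norm_nonneg _
    rw [hterm, hR, ← le_div_iff₀' hT0, htr] at h1
    linarith [Real.add_one_le_exp (-(2 * Real.pi * ((T.trace + 2 * (wq ⬝ᵥ T *ᵥ vq) * h +
      (vq ⬝ᵥ T *ᵥ vq) * (wq ⬝ᵥ wq) * h ^ 2 : ℚ) : ℝ)))]
  have hc : 0 < -(2 * Real.pi * (((vq ⬝ᵥ T *ᵥ vq) * (wq ⬝ᵥ wq) : ℚ) : ℝ)) := by
    have : (((vq ⬝ᵥ T *ᵥ vq) * (wq ⬝ᵥ wq) : ℚ) : ℝ) < 0 := by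
      exact_mod_cast mul_neg_of_neg_of_pos hv hww
    nlinarith [Real.pi_pos]
  have hlim : Tendsto (fun h : ℕ => -(2 * Real.pi * ((T.trace + 2 * (wq ⬝ᵥ T *ᵥ vq) * h +
      (vq ⬝ᵥ T *ᵥ vq) * (wq ⬝ᵥ wq) * h ^ 2 : ℚ) : ℝ))) atTop atTop := by
    have h1 : Tendsto (fun h : ℕ => -(2 * Real.pi * (T.trace : ℝ)) + (h : ℝ) *
        (-(2 * Real.pi * ((2 * (wq ⬝ᵥ T *ᵥ vq) : ℚ) : ℝ)) +
          -(2 * Real.pi * (((vq ⬝ᵥ T *ᵥ vq) * (wq ⬝ᵥ wq) : ℚ) : ℝ)) * (h : ℝ))) atTop atTop :=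
      tendsto_atTop_add_const_left _ _ (tendsto_natCast_atTop_atTop.atTop_mul_atTop₀
        (tendsto_atTop_add_const_left _ _ (tendsto_natCast_atTop_atTop.const_mul_atTop hc)))
    refine h1.congr fun h => ?_
    push_cast
    ring
  obtain ⟨h, hh⟩ := (hlim.eventually_gt_atTop (K / ‖A T‖)).exists
  exact absurd (hbound h) (not_le.2 hh)

end Koecher

section Transformation

variable {m : ℕ} {k : ℤ} {F : Matrix (Fin m ⊕ Unit) (Fin m ⊕ Unit) ℂ → ℂ}
  {A : Matrix (Fin m ⊕ Unit) (Fin m ⊕ Unit) ℚ → ℂ} {S : Matrix (Fin m) (Fin m) ℚ}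

lemma HasFourierSeries.fjCoeff_transform (hA : HasFourierSeries F A) (hS : S.IsSymm)
    (hpd : PosDefQ S) {P : Matrix (Fin m) (Fin m) ℂ} (hP : P.IsSymm) {u u' : Fin m → ℂ}
    {τ τ' μ : ℂ} (hτ : 0 < τ.im) (hτ' : 0 < τ'.im)
    (h : ∀ W, blockPoint W u τ ∈ SiegelHalfSpace (Fin m ⊕ Unit) →
      F (blockPoint (W + P) u' τ') = μ * F (blockPoint W u τ)) :
    eFun (trPair S P) * fjCoeff A S (τ', u') = μ * fjCoeff A S (τ, u) := by
  obtain ⟨y, h0, h1⟩ := ((eventually_blockPoint_mem (W := 0) (by simp [Matrix.IsSymm]) u hτ).and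
    (eventually_blockPoint_mem hP u' hτ')).exists
  rw [zero_add] at h0
  have key := hA.fjCoeff_eq hS hpd (μ := μ) h0 h1 fun X hX => by
    rw [← h _ (blockPoint_add_mem h0 hX)]
    congr 2
    abel
  rw [trPair_add, eFun_add] at key
  refine mul_left_cancel₀ (eFun_ne_zero (trPair S (((y : ℂ) * Complex.I) • 1))) ?_
  linear_combination key

lemma IsModular.apply_blockPoint_add_right (hF : IsModular k F) (y : Fin m → ℤ)
    {W : Matrix (Fin m) (Fin m) ℂ} {u : Fin m → ℂ} {τ : ℂ}
    (h : blockPoint W u τ ∈ SiegelHalfSpace (Fin m ⊕ Unit)) :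
    F (blockPoint W (fun i => u i + y i) τ) = F (blockPoint W u τ) := by
  have hB : (fromBlocks 0 (replicateCol Unit y) (replicateRow Unit y) 0).IsSymm := by
    ext (i | i) (j | j) <;> simp
  rw [← hF.apply_add hB h]
  congr 1
  ext (i | i) (j | j) <;> simp [blockPoint]

lemma IsModular.apply_blockPoint_add_left (hF : IsModular k F) (x : Fin m → ℤ)
    {W : Matrix (Fin m) (Fin m) ℂ} {u : Fin m → ℂ} {τ : ℂ}
    (h : blockPoint W u τ ∈ SiegelHalfSpace (Fin m ⊕ Unit)) :
    F (blockPoint (W + (vecMulVec (fun i => (x i : ℂ)) u + vecMulVec u (fun i => (x i : ℂ)) +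
        τ • vecMulVec (fun i => (x i : ℂ)) (fun i => (x i : ℂ)))) (fun i => u i + x i * τ) τ) =
      F (blockPoint W u τ) := by
  have hVU : fromBlocks (1 : Matrix (Fin m) (Fin m) ℤ) (-replicateCol Unit x) 0
      (1 : Matrix Unit Unit ℤ) *
      fromBlocks (1 : Matrix (Fin m) (Fin m) ℤ) (replicateCol Unit x) 0 1 = 1 := by
    simp [fromBlocks_multiply]
  have hV : (fromBlocks (1 : Matrix (Fin m) (Fin m) ℤ) (-replicateCol Unit x) 0 1).det = 1 := by
    simp
  rw [← hF.apply_conj hVU hV h]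
  congr 1
  rw [fromBlocks_map, blockPoint, blockPoint, fromBlocks_transpose, fromBlocks_multiply,
    fromBlocks_multiply]
  ext (i | i) (j | j) <;> simp [Matrix.mul_apply, vecMulVec_apply] <;> ring

lemma IsModular.apply_blockPoint_moebius (hF : IsModular k F) {a b c d : ℤ}
    (hdet : a * d - b * c = 1) {W : Matrix (Fin m) (Fin m) ℂ} {u : Fin m → ℂ} {τ : ℂ}
    (hj : (c : ℂ) * τ + d ≠ 0) (h : blockPoint W u τ ∈ SiegelHalfSpace (Fin m ⊕ Unit)) :
    F (blockPoint (W + (-(c / (c * τ + d)) : ℂ) • vecMulVec u u) (fun i => u i / (c * τ + d))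
        ((a * τ + b) / (c * τ + d))) = (c * τ + d) ^ k * F (blockPoint W u τ) := by
  let s : ℤ → Matrix Unit Unit ℤ := fun z => diagonal fun _ => z
  let g : Matrix ((Fin m ⊕ Unit) ⊕ (Fin m ⊕ Unit)) ((Fin m ⊕ Unit) ⊕ (Fin m ⊕ Unit)) ℤ :=
    fromBlocks (fromBlocks 1 0 0 (s a)) (fromBlocks 0 0 0 (s b)) (fromBlocks 0 0 0 (s c))
      (fromBlocks 1 0 0 (s d))
  have hg : g ∈ SpSet (Fin m ⊕ Unit) := by
    change gᵀ * Jmat _ * g = Jmat _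
    rw [Jmat, fromBlocks_transpose, fromBlocks_multiply, fromBlocks_multiply]
    ext ((i | i) | (i | i)) ((j | j) | (j | j)) <;>
      simp [s, fromBlocks_transpose, fromBlocks_multiply, Matrix.one_apply, eq_comm] <;> linarith
  have hD : blkC g * blockPoint W u τ + blkD g =
      fromBlocks 1 0 (replicateRow Unit fun i => c * u i) (of fun _ _ => c * τ + d) := by
    ext (i | i) (j | j) <;>
      simp [blkC, blkD, toBlocks₂₁, toBlocks₂₂, g, s, blockPoint, Matrix.mul_apply,
        Matrix.one_apply]
  have hN : blkA g * blockPoint W u τ + blkB g =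
      fromBlocks W (replicateCol Unit u) (replicateRow Unit fun i => a * u i)
        (of fun _ _ => a * τ + b) := by
    ext (i | i) (j | j) <;>
      simp [blkA, blkB, toBlocks₁₁, toBlocks₁₂, g, s, blockPoint, Matrix.mul_apply,
        Matrix.one_apply]
  have hjf : jfac g (blockPoint W u τ) = c * τ + d := by
    rw [jfac, hD, det_fromBlocks_zero₁₂]; simp
  have hact : actSp g (blockPoint W u τ) =
      blockPoint (W + (-(c / (c * τ + d)) : ℂ) • vecMulVec u u) (fun i => u i / (c * τ + d))
        ((a * τ + b) / (c * τ + d)) := by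
    have hu : IsUnit (blkC g * blockPoint W u τ + blkD g).det := by
      change IsUnit (jfac g (blockPoint W u τ))
      rw [hjf]; exact hj.isUnit
    have hdet' : (a * d - b * c : ℂ) = 1 := by exact_mod_cast hdet
    have hEq : blkA g * blockPoint W u τ + blkB g =
        blockPoint (W + (-(c / (c * τ + d)) : ℂ) • vecMulVec u u) (fun i => u i / (c * τ + d))
          ((a * τ + b) / (c * τ + d)) * (blkC g * blockPoint W u τ + blkD g) := by
      rw [hN, hD, blockPoint, fromBlocks_multiply]
      ext (i | i) (j | j)
      · simp [Matrix.mul_apply, vecMulVec_apply]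
        field_simp
        ring
      · simp [Matrix.mul_apply, hj]
      · simp [Matrix.mul_apply]
        field_simp
        linear_combination (u j) * hdet'
      · simp [Matrix.mul_apply, hj]
    rw [actSp, hEq, Matrix.mul_nonsing_inv_cancel_right _ _ hu]
  rw [← hact, ← hjf]
  exact hF g hg _ h

end Transformation

section JacobiTransformation

variable {m : ℕ} {k : ℤ} {F : Matrix (Fin m ⊕ Unit) (Fin m ⊕ Unit) ℂ → ℂ}
  {A : Matrix (Fin m ⊕ Unit) (Fin m ⊕ Unit) ℚ → ℂ} {S : Matrix (Fin m) (Fin m) ℚ}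

lemma moebius_denom_ne_zero {a b c d : ℤ} (hdet : a * d - b * c = 1) {τ : ℂ} (hτ : 0 < τ.im) :
    (c : ℂ) * τ + d ≠ 0 := by
  intro h
  have him : (c : ℝ) * τ.im = 0 := by simpa using congrArg Complex.im h
  have hc : c = 0 := by
    exact_mod_cast (mul_eq_zero.1 him).resolve_right hτ.ne'
  subst hc
  have hd : d = 0 := by
    have h' : (d : ℂ) = 0 := by simpa using h
    exact_mod_cast h'
  simp [hd] at hdet

lemma moebius_im_pos {a b c d : ℤ} (hdet : a * d - b * c = 1) {τ : ℂ} (hτ : 0 < τ.im) :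
    0 < (((a : ℂ) * τ + b) / (c * τ + d)).im := by
  have hj := Complex.normSq_pos.2 (moebius_denom_ne_zero hdet hτ)
  have hdet' : (a * d - b * c : ℝ) = 1 := by exact_mod_cast hdet
  have h : (((a : ℂ) * τ + b) / (c * τ + d)).im = τ.im / Complex.normSq (c * τ + d) := by
    rw [Complex.div_im, ← sub_div]
    congr 1
    simp
    linear_combination τ.im * hdet'
  rw [h]
  exact div_pos hτ hj

lemma HasFourierSeries.fjCoeff_moebius (hA : HasFourierSeries F A) (hF : IsModular k F)
    (hS : S.IsSymm) (hpd : PosDefQ S) {a b c d : ℤ} (hdet : a * d - b * c = 1) {τ : ℂ}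
    (hτ : 0 < τ.im) (u : Fin m → ℂ) :
    fjCoeff A S (((a : ℂ) * τ + b) / (c * τ + d), fun i => u i / (c * τ + d)) =
      (c * τ + d) ^ k * eFun (c * sigmaC S u u / (c * τ + d)) * fjCoeff A S (τ, u) := by
  have hj := moebius_denom_ne_zero hdet hτ
  have hP : ((-(c / (c * τ + d)) : ℂ) • vecMulVec u u).IsSymm := by
    rw [Matrix.IsSymm, transpose_smul, transpose_vecMulVec]
  have key := hA.fjCoeff_transform hS hpd hP hτ (moebius_im_pos hdet hτ) fun W hW =>
    hF.apply_blockPoint_moebius hdet hj hW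
  have hcancel : eFun (c * sigmaC S u u / (c * τ + d)) *
      eFun (trPair S ((-(c / (c * τ + d)) : ℂ) • vecMulVec u u)) = 1 := by
    rw [← eFun_add, trPair_smul, trPair_vecMulVec, ← eFun_zero]
    congr 1
    ring
  linear_combination eFun (c * sigmaC S u u / (c * τ + d)) * key -
    fjCoeff A S (((a : ℂ) * τ + b) / (c * τ + d), fun i => u i / (c * τ + d)) * hcancel

lemma HasFourierSeries.fjCoeff_add_lattice (hA : HasFourierSeries F A) (hF : IsModular k F)
    (hS : S.IsSymm) (hpd : PosDefQ S) (x y : Fin m → ℤ) {τ : ℂ} (hτ : 0 < τ.im) (u : Fin m → ℂ) :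
    fjCoeff A S (τ, fun i => u i + (x i : ℂ) * τ + (y i : ℂ)) =
      eFun (-(sigmaC S (fun i => (x i : ℂ)) (fun i => (x i : ℂ)) * τ
        + 2 * sigmaC S (fun i => (x i : ℂ)) u)) * fjCoeff A S (τ, u) := by
  have hy := hA.fjCoeff_transform hS hpd (P := 0) (u := fun i => u i + x i * τ)
    (u' := fun i => u i + x i * τ + y i) (μ := 1) (by simp [Matrix.IsSymm]) hτ hτ fun W hW => by
      rw [add_zero, one_mul]
      exact hF.apply_blockPoint_add_right y hW
  have hP : (vecMulVec (fun i => (x i : ℂ)) u + vecMulVec u (fun i => (x i : ℂ)) +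
      τ • vecMulVec (fun i => (x i : ℂ)) (fun i => (x i : ℂ))).IsSymm := by
    rw [Matrix.IsSymm, transpose_add, transpose_add, transpose_smul, transpose_vecMulVec,
      transpose_vecMulVec, transpose_vecMulVec, add_comm (vecMulVec u _)]
  have hx := hA.fjCoeff_transform hS hpd (μ := 1) hP hτ hτ
    fun W hW => (hF.apply_blockPoint_add_left x hW).trans (one_mul _).symm
  have h0 : trPair S (0 : Matrix (Fin m) (Fin m) ℂ) = 0 := by simp [trPair]
  rw [h0, eFun_zero, one_mul, one_mul] at hy
  rw [one_mul, trPair_add, trPair_add, trPair_smul, trPair_vecMulVec, trPair_vecMulVec,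
    trPair_vecMulVec, sigmaC_comm hS u] at hx
  rw [hy, ← hx, ← mul_assoc, ← eFun_add]
  convert (one_mul _).symm
  rw [← eFun_zero]
  congr 1
  ring

end JacobiTransformation

/-- the Fourier–Jacobi coefficients (for positive definite index `S`) of a
Siegel modular form of weight `k` on `ℍ_{2n}` for `Sp₄ₙ(ℤ)` are Jacobi forms of weight `k`
and index `S`.  Here `ℍ_{2n}` is indexed by `Fin (2n-1) ⊕ Unit`, so that the block
decomposition `Z = (W, u; ᵀu, τ)` is built into the index type. -/
theorem fourier_jacobi_coefficients_are_jacobi_forms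
    (n m : ℕ) (hn : 1 ≤ n) (hm : m + 1 = 2 * n) (k : ℤ)
    (F : Matrix (Fin m ⊕ Unit) (Fin m ⊕ Unit) ℂ → ℂ)
    (hol : HoloOn F (SiegelHalfSpace (Fin m ⊕ Unit)))
    (hmod : ∀ g ∈ SpSet (Fin m ⊕ Unit), ∀ Z ∈ SiegelHalfSpace (Fin m ⊕ Unit),
      F (actSp g Z) = jfac g Z ^ k * F Z)
    (A : Matrix (Fin m ⊕ Unit) (Fin m ⊕ Unit) ℚ → ℂ)
    (hsupp : ∀ T, ¬ IsHalfIntegral T → A T = 0)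
    (hfourier : ∀ Z ∈ SiegelHalfSpace (Fin m ⊕ Unit),
      HasSum (fun T : {T : Matrix (Fin m ⊕ Unit) (Fin m ⊕ Unit) ℚ // IsHalfIntegral T} =>
        A T * eFun (trPair (T : Matrix (Fin m ⊕ Unit) (Fin m ⊕ Unit) ℚ) Z)) (F Z)) :
    ∀ S : Matrix (Fin m) (Fin m) ℚ, IsHalfIntegral S → PosDefQ S →
      IsJacobiForm m k S (fjCoeff A S) (fun N ξ => A (borderMat S ξ (N : ℚ))) := by
  have hF : IsModular k F := hmod
  have hA : HasFourierSeries F A := by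
    refine ⟨hsupp, fun Z hZ => ?_⟩
    refine (hasSum_subtype_iff_of_support_subset (s := {T | IsHalfIntegral T}) ?_).1 (hfourier Z hZ)
    intro T hT
    by_contra h
    exact hT (by simp [hsupp T h])
  intro S hS hpd
  refine ⟨hA.differentiableOn_fjCoeff hS.1 hpd, ?_, ?_, fun τ hτ u =>
    (hA.summable_fjCoeff hS.1 hpd hτ u).hasSum, fun N ξ h => ?_⟩
  · intro a b c d hdet τ hτ u
    exact hA.fjCoeff_moebius hF hS.1 hpd hdet hτ u
  · intro x y τ hτ u
    exact hA.fjCoeff_add_lattice hF hS.1 hpd x y hτ u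
  · by_contra h0
    have : Nontrivial (Fin m ⊕ Unit) := ⟨Sum.inl ⟨0, by omega⟩, Sum.inr (), by simp⟩
    exact h ⟨by_contra fun h' => h0 (hsupp _ h'), hA.posSemidef_of_coeff_ne_zero hF h0⟩
end
end

section
/- For every n ≥ 1, the group Sp₄ₙ(ℤ) is generated by the two subgroups P(ℤ) = {(A, B; 0, ᵀA⁻¹) ∈ Sp₄ₙ(ℤ) : A ∈ GL_{2n}(ℤ)} (the integral points of the Siegel parabolic) and H(ℤ), the image of SL₂(ℤ) under the embedding sending (a,b;c,d) to the 4n×4n symplectic matrix equal to the identity except for the entries a, b, c, d placed at positions (2n,2n), (2n,4n), (4n,2n), (4n,4n) respectively. -/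
open Matrix

noncomputable section

/-- The last index of `Fin m` (for `0 < m`). -/
def lastIdx (m : ℕ) (h : 0 < m) : Fin m := ⟨m - 1, by omega⟩

/-- The embedding of `SL₂` into `Sp₄ₙ` sending `(a,b;c,d)` to the `4n × 4n` matrix equal to
the identity except for the entries `a, b, c, d` placed at the last positions of the four
`2n × 2n` blocks. -/
def Hembed (n : ℕ) (hn : 0 < n) (γ : Matrix (Fin 2) (Fin 2) ℤ) :
    Matrix (Fin (2 * n) ⊕ Fin (2 * n)) (Fin (2 * n) ⊕ Fin (2 * n)) ℤ :=
  fun p q =>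
    match p, q with
    | Sum.inl i, Sum.inl j =>
        if i = lastIdx (2 * n) (by omega) ∧ j = lastIdx (2 * n) (by omega) then γ 0 0
        else if i = j then 1 else 0
    | Sum.inl i, Sum.inr j =>
        if i = lastIdx (2 * n) (by omega) ∧ j = lastIdx (2 * n) (by omega) then γ 0 1 else 0
    | Sum.inr i, Sum.inl j =>
        if i = lastIdx (2 * n) (by omega) ∧ j = lastIdx (2 * n) (by omega) then γ 1 0 else 0
    | Sum.inr i, Sum.inr j =>
        if i = lastIdx (2 * n) (by omega) ∧ j = lastIdx (2 * n) (by omega) then γ 1 1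
        else if i = j then 1 else 0

namespace SymplecticGroup

variable {l : Type*} [DecidableEq l] [Fintype l]

/-- The Siegel Levi element adding `q` times row `inl i` to row `inl k` and subtracting
`q` times row `inr k` from row `inr i`. -/
def levi (i k : l) (h : i ≠ k) (q : ℤ) : symplecticGroup l ℤ :=
  ⟨fromBlocks (transvection k i q) 0 0 (transvection i k (-q)), by
    refine fromBlocks_mem_iff.2 ⟨by simp, by simp, ?_⟩
    have : (transvection k i q)ᵀ = transvection i k q := by
      simp [transvection, transpose_add]
    rw [this, transvection_mul_transvection_same _ _ h]
    simp⟩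

/-- The Siegel unipotent element adding `q` times row `inr k` to row `inl k`. -/
def upper (k : l) (q : ℤ) : symplecticGroup l ℤ :=
  ⟨fromBlocks 1 (single k k q) 0 1, fromBlocks_mem_iff.2 ⟨by simp, by simp, by simp⟩⟩

/-- The quarter turn in the hyperbolic plane spanned by the coordinates `inl k`, `inr k`. -/
def quarterTurn (k : l) : symplecticGroup l ℤ :=
  ⟨fromBlocks (1 - single k k 1) (-single k k 1) (single k k 1) (1 - single k k 1), by
    refine fromBlocks_mem_iff.2 ⟨?_, ?_, ?_⟩ <;>
      simp [transpose_sub, mul_sub, sub_mul]⟩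

/-- The permutation of coordinates swapping `a` and `b` in both Lagrangian halves. -/
def swapElement (a b : l) : symplecticGroup l ℤ :=
  ⟨fromBlocks ((Equiv.swap a b).permMatrix ℤ) 0 0 ((Equiv.swap a b).permMatrix ℤ), by
    refine fromBlocks_mem_iff.2 ⟨by simp, by simp, ?_⟩
    rw [transpose_permMatrix, ← permMatrix_mul]
    simp⟩

theorem swapElement_mul_quarterTurn (a b : l) :
    swapElement a b * quarterTurn a = quarterTurn b * swapElement a b := by
  have h : (Equiv.swap a b).permMatrix ℤ * single a a 1 =
      single b b 1 * (Equiv.swap a b).permMatrix ℤ := by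
    rw [Equiv.Perm.permMatrix, PEquiv.toMatrix_toPEquiv_mul, PEquiv.mul_toMatrix_toPEquiv]
    ext i j
    simp only [submatrix_apply, single_apply, id, Equiv.symm_swap, Equiv.swap_apply_def]
    grind
  apply Subtype.ext
  simp [swapElement, quarterTurn, fromBlocks_multiply, mul_sub, sub_mul, h]

theorem levi_mul_apply (i k : l) (h : i ≠ k) (q : ℤ) (M : symplecticGroup l ℤ) (r p : l ⊕ l) :
    (levi i k h q * M).1 r p = M.1 r p + (if r = .inl k then q * M.1 (.inl i) p else 0) -
      (if r = .inr i then q * M.1 (.inr k) p else 0) := by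
  rcases r with r | r
  · simp [levi, mul_apply, transvection, add_mul, Finset.sum_add_distrib, one_apply, single_apply,
      ite_and, eq_comm]
  · rcases eq_or_ne r i with rfl | hr
    · simp [levi, mul_apply, transvection, add_mul, Finset.sum_add_distrib, one_apply,
        single_apply, sub_eq_add_neg]
    · simp [levi, mul_apply, transvection, one_apply, hr, Ne.symm hr]

theorem quarterTurn_mul_apply (k : l) (M : symplecticGroup l ℤ) (r p : l ⊕ l) :
    (quarterTurn k * M).1 r p = if r = .inl k then -M.1 (.inr k) p else
      if r = .inr k then M.1 (.inl k) p else M.1 r p := by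
  rcases r with r | r <;> rcases eq_or_ne r k with rfl | hr <;>
    simp [quarterTurn, mul_apply, one_apply, single_apply, *, Ne.symm]

theorem upper_mul_apply (k : l) (q : ℤ) (M : symplecticGroup l ℤ) (r p : l ⊕ l) :
    (upper k q * M).1 r p = M.1 r p + if r = .inl k then q * M.1 (.inr k) p else 0 := by
  rcases r with r | r <;> by_cases hr : r = k <;>
    simp [upper, mul_apply, one_apply, single_apply, ite_and, eq_comm, hr]

/-- The columns `inl i` of `M`, for `i ∈ s`, are standard basis vectors. -/
def IsStandardOn (s : Finset l) (M : symplecticGroup l ℤ) : Prop :=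
  ∀ i ∈ s, ∀ r, M.1 r (.inl i) = if r = .inl i then 1 else 0

section Reduction

variable {s : Finset l} {M : symplecticGroup l ℤ} {i j k : l}

theorem IsStandardOn.levi_mul (hM : IsStandardOn s M) (hi : i ∉ s) (h : i ≠ k) (q : ℤ) :
    IsStandardOn s (levi i k h q * M) := by
  intro m hm r
  have : i ≠ m := fun e => hi (e ▸ hm)
  simp [levi_mul_apply, hM m hm, this]

theorem IsStandardOn.upper_mul (hM : IsStandardOn s M) (q : ℤ) :
    IsStandardOn s (upper k q * M) := by
  intro m hm r
  simp [upper_mul_apply, hM m hm]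

theorem IsStandardOn.quarterTurn_mul (hM : IsStandardOn s M) (hk : k ∉ s) :
    IsStandardOn s (quarterTurn k * M) := by
  intro m hm r
  have : k ≠ m := fun e => hk (e ▸ hm)
  simp only [quarterTurn_mul_apply, hM m hm]
  grind

/-- A finite sum of absolute values strictly decreases when one entry does. -/
theorem sum_natAbs_lt {ι : Type*} {t : Finset ι} {f g : ι → ℤ} {a : ι} (ha : a ∈ t)
    (hlt : |g a| < |f a|) (heq : ∀ b ∈ t, b ≠ a → g b = f b) :
    ∑ b ∈ t, (g b).natAbs < ∑ b ∈ t, (f b).natAbs := by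
  have hlt' : (g a).natAbs < (f a).natAbs := by
    rwa [Int.abs_eq_natAbs, Int.abs_eq_natAbs, Nat.cast_lt] at hlt
  refine Finset.sum_lt_sum (fun b hb => ?_) ⟨a, ha, hlt'⟩
  by_cases h : b = a
  · rw [h]; exact hlt'.le
  · rw [heq b hb h]

variable {G : Subgroup (symplecticGroup l ℤ)}

theorem mem_of_pivot_eq_one (hlevi : ∀ i k h q, levi i k h q ∈ G)
    (H : ∀ M, IsStandardOn (insert j s) M → M ∈ G) (hj : j ∉ s) (hM : IsStandardOn s M)
    (hC : ∀ i, M.1 (.inr i) (.inl j) = 0) (hA : M.1 (.inl j) (.inl j) = 1) : M ∈ G := by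
  induction hN : ∑ i, (M.1 (.inl i) (.inl j)).natAbs using Nat.strong_induction_on
    generalizing M with
  | _ N ih =>
  by_cases h : ∃ i, i ≠ j ∧ M.1 (.inl i) (.inl j) ≠ 0
  · obtain ⟨i, hij, hi⟩ := h
    rw [← Subgroup.mul_mem_cancel_left G (hlevi j i hij.symm (-M.1 (.inl i) (.inl j)))]
    refine ih _ ?_ (hM.levi_mul hj _ _) ?_ ?_ rfl
    · rw [← hN]
      refine sum_natAbs_lt (Finset.mem_univ i) ?_ fun b _ hb => ?_
      · simpa [levi_mul_apply, hA] using hi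
      · simp [levi_mul_apply, hb]
    · intro b; simp [levi_mul_apply, hC]
    · simp [levi_mul_apply, hij.symm, hA]
  · push Not at h
    refine H M fun i hi r => ?_
    rcases Finset.mem_insert.1 hi with rfl | hi
    · rcases r with r | r
      · by_cases hr : r = i
        · simp [hr, hA]
        · simp [hr, h r hr]
      · simp [hC]
    · exact hM i hi r

/-- The pairing of the `j`-th column with its symplectic dual. -/
theorem sum_mul_eq_one (M : symplecticGroup l ℤ) (hC : ∀ i, M.1 (.inr i) (.inl j) = 0) :
    ∑ i, M.1 (.inl i) (.inl j) * M.1 (.inr i) (.inr j) = 1 := by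
  have h := M.2
  rw [← fromBlocks_toBlocks M.1, fromBlocks_mem_iff] at h
  simpa [toBlocks₁₁, toBlocks₁₂, toBlocks₂₁, toBlocks₂₂, mul_apply, hC] using congr_fun₂ h.2.2 j j

theorem IsStandardOn.inr_inr_eq_zero (hM : IsStandardOn s M) (hi : i ∈ s) (hj : j ∉ s) :
    M.1 (.inr i) (.inr j) = 0 := by
  have h := M.2
  rw [← fromBlocks_toBlocks M.1, fromBlocks_mem_iff] at h
  have hij : i ≠ j := fun e => hj (e ▸ hi)
  simpa [toBlocks₁₁, toBlocks₁₂, toBlocks₂₁, toBlocks₂₂, mul_apply, hM i hi, hij] using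
    congr_fun₂ h.2.2 i j

theorem IsStandardOn.inr_inl_eq_zero (hM : IsStandardOn s M) (hi : i ∈ s) :
    M.1 (.inr i) (.inl j) = 0 := by
  have h := M.2
  rw [← fromBlocks_toBlocks M.1, fromBlocks_mem_iff] at h
  simpa [toBlocks₁₁, toBlocks₁₂, toBlocks₂₁, toBlocks₂₂, mul_apply, hM i hi] using
    congr_fun₂ h.1 i j

theorem mem_of_pivot_isUnit (hlevi : ∀ i k h q, levi i k h q ∈ G)
    (hturn : ∀ k, quarterTurn k ∈ G)
    (H : ∀ M, IsStandardOn (insert j s) M → M ∈ G) (hj : j ∉ s) (hM : IsStandardOn s M)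
    (hC : ∀ i, M.1 (.inr i) (.inl j) = 0) (hk : k ∉ s)
    (hA : IsUnit (M.1 (.inl k) (.inl j))) : M ∈ G := by
  rcases eq_or_ne k j with rfl | hkj
  · rcases Int.isUnit_iff.1 hA with h1 | h1
    · exact mem_of_pivot_eq_one hlevi H hj hM hC h1
    · rw [← Subgroup.mul_mem_cancel_left G (hturn k), ← Subgroup.mul_mem_cancel_left G (hturn k)]
      refine mem_of_pivot_eq_one hlevi H hj ((hM.quarterTurn_mul hj).quarterTurn_mul hj) ?_ ?_
      · intro i; simp +contextual [quarterTurn_mul_apply, hC]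
      · simp [quarterTurn_mul_apply, h1]
  · rw [← Subgroup.mul_mem_cancel_left G (hlevi k j hkj
      ((1 - M.1 (.inl j) (.inl j)) * M.1 (.inl k) (.inl j)))]
    refine mem_of_pivot_eq_one hlevi H hj (hM.levi_mul hk _ _) ?_ ?_
    · intro i; simp [levi_mul_apply, hC]
    · simp [levi_mul_apply, mul_assoc, Int.isUnit_mul_self hA]

theorem mem_of_column_inr_eq_zero (hlevi : ∀ i k h q, levi i k h q ∈ G)
    (hturn : ∀ k, quarterTurn k ∈ G)
    (H : ∀ M, IsStandardOn (insert j s) M → M ∈ G) (hj : j ∉ s) (hM : IsStandardOn s M)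
    (hC : ∀ i, M.1 (.inr i) (.inl j) = 0) : M ∈ G := by
  induction hN : ∑ i ∈ sᶜ, (M.1 (.inl i) (.inl j)).natAbs using Nat.strong_induction_on
    generalizing M with
  | _ N ih =>
  by_cases h : ∃ k i, k ∉ s ∧ i ∉ s ∧ k ≠ i ∧ M.1 (.inl k) (.inl j) ≠ 0 ∧
      |M.1 (.inl k) (.inl j)| ≤ |M.1 (.inl i) (.inl j)|
  · obtain ⟨k, i, hk, hi, hki, hk0, hle⟩ := h
    rw [← Subgroup.mul_mem_cancel_left G
      (hlevi k i hki (-(M.1 (.inl i) (.inl j) / M.1 (.inl k) (.inl j))))]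
    refine ih _ ?_ (hM.levi_mul hk _ _) ?_ rfl
    · rw [← hN]
      refine sum_natAbs_lt (a := i) (by simpa) (lt_of_lt_of_le ?_ hle) fun b _ hb => ?_
      · rw [levi_mul_apply, if_pos rfl, if_neg (by simp), sub_zero, neg_mul, ← sub_eq_add_neg,
          mul_comm, ← Int.emod_def, abs_of_nonneg (Int.emod_nonneg _ hk0)]
        exact Int.emod_lt_abs _ hk0
      · simp [levi_mul_apply, hb]
    · intro b; simp [levi_mul_apply, hC]
  · push Not at h
    have hsum := sum_mul_eq_one M hC
    obtain ⟨k, -, hk⟩ := Finset.exists_ne_zero_of_sum_ne_zero (hsum.trans_ne one_ne_zero)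
    have hks : k ∉ s := fun hks => hk (by rw [hM.inr_inr_eq_zero hks hj, mul_zero])
    have hk0 := left_ne_zero_of_mul hk
    rw [Finset.sum_eq_single k] at hsum
    · exact mem_of_pivot_isUnit hlevi hturn H hj hM hC hks (.of_mul_eq_one _ hsum)
    · intro i _ hik
      by_cases his : i ∈ s
      · rw [hM.inr_inr_eq_zero his hj, mul_zero]
      · by_contra hi
        have h1 := h k i hks his hik.symm hk0
        have h2 := h i k his hks hik (left_ne_zero_of_mul hi)
        exact lt_asymm h1 h2
    · simp

theorem mem_of_isStandardOn_step (hlevi : ∀ i k h q, levi i k h q ∈ G)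
    (hupper : ∀ k q, upper k q ∈ G) (hturn : ∀ k, quarterTurn k ∈ G)
    (H : ∀ M, IsStandardOn (insert j s) M → M ∈ G) (hj : j ∉ s) (hM : IsStandardOn s M) :
    M ∈ G := by
  induction hN : ∑ i, (M.1 (.inr i) (.inl j)).natAbs using Nat.strong_induction_on
    generalizing M with
  | _ N ih =>
  by_cases hC : ∀ i, M.1 (.inr i) (.inl j) = 0
  · exact mem_of_column_inr_eq_zero hlevi hturn H hj hM hC
  by_cases h : ∃ k i, i ≠ k ∧ M.1 (.inr k) (.inl j) ≠ 0 ∧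
      |M.1 (.inr k) (.inl j)| ≤ |M.1 (.inr i) (.inl j)|
  · obtain ⟨k, i, hki, hk0, hle⟩ := h
    have hi : i ∉ s := fun hi => by simp [hM.inr_inl_eq_zero hi, hk0] at hle
    rw [← Subgroup.mul_mem_cancel_left G
      (hlevi i k hki (M.1 (.inr i) (.inl j) / M.1 (.inr k) (.inl j)))]
    refine ih _ ?_ (hM.levi_mul hi _ _) rfl
    rw [← hN]
    refine sum_natAbs_lt (Finset.mem_univ i) (lt_of_lt_of_le ?_ hle) fun b _ hb => ?_
    · rw [levi_mul_apply, if_neg (by simp), if_pos rfl, add_zero,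
          mul_comm, ← Int.emod_def, abs_of_nonneg (Int.emod_nonneg _ hk0)]
      exact Int.emod_lt_abs _ hk0
    · simp [levi_mul_apply, hb]
  · push Not at h hC
    obtain ⟨k, hk0⟩ := hC
    have hk : k ∉ s := fun hk => hk0 (hM.inr_inl_eq_zero hk)
    rw [← Subgroup.mul_mem_cancel_left G
      (hupper k (-(M.1 (.inl k) (.inl j) / M.1 (.inr k) (.inl j)))),
      ← Subgroup.mul_mem_cancel_left G (hturn k)]
    refine ih _ ?_ (hM.upper_mul _ |>.quarterTurn_mul hk) rfl
    rw [← hN]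
    refine sum_natAbs_lt (Finset.mem_univ k) ?_ fun b _ hb => ?_
    · rw [quarterTurn_mul_apply, if_neg (by simp), if_pos rfl, upper_mul_apply, if_pos rfl,
          neg_mul, ← sub_eq_add_neg, mul_comm, ← Int.emod_def,
          abs_of_nonneg (Int.emod_nonneg _ hk0)]
      exact Int.emod_lt_abs _ hk0
    · simp [quarterTurn_mul_apply, upper_mul_apply, hb]

/-- A subgroup containing the integral Siegel parabolic and one quarter turn is everything. -/
theorem eq_top_of_parabolic_of_quarterTurn
    (hP : ∀ M : symplecticGroup l ℤ, M.1.toBlocks₂₁ = 0 → M ∈ G)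
    (hk : quarterTurn k ∈ G) : G = ⊤ := by
  have hlevi : ∀ i k h q, levi (l := l) i k h q ∈ G := fun i k h q => hP _ (by simp [levi])
  have hupper : ∀ k q, upper (l := l) k q ∈ G := fun k q => hP _ (by simp [upper])
  have hturn : ∀ k : l, quarterTurn k ∈ G := fun b => by
    have hs : swapElement k b ∈ G := hP _ (by simp [swapElement])
    rw [← Subgroup.mul_mem_cancel_right G hs, ← swapElement_mul_quarterTurn]
    exact mul_mem hs hk
  have hstd : ∀ (t : Finset l) (M : symplecticGroup l ℤ), IsStandardOn tᶜ M → M ∈ G := by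
    intro t
    induction t using Finset.induction_on with
    | empty =>
      intro M hM
      refine hP M ?_
      ext i j
      simp [toBlocks₂₁, hM j (by simp)]
    | insert j t hj ih =>
      intro M hM
      refine mem_of_isStandardOn_step (j := j) hlevi hupper hturn (fun M' hM' => ih M' ?_)
        (by simp) hM
      rwa [← Finset.compl_erase, Finset.erase_insert hj] at hM'
  rw [Subgroup.eq_top_iff']
  exact fun M => hstd Finset.univ M fun i hi => by simp at hi

end Reduction

end SymplecticGroup

/-- `Sp₄ₙ(ℤ)` is generated by the integral Siegel parabolic `P(ℤ)`
(the block upper-triangular symplectic matrices) together with the image `H(ℤ)` of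
`SL₂(ℤ)` under the embedding `Hembed`. -/
theorem sp_generated_by_parabolic_and_SL2 (n : ℕ) (hn : 0 < n) :
    Subgroup.closure
      ({M : Matrix.symplecticGroup (Fin (2 * n)) ℤ |
          (M : Matrix (Fin (2 * n) ⊕ Fin (2 * n)) (Fin (2 * n) ⊕ Fin (2 * n)) ℤ).toBlocks₂₁ = 0} ∪
        {M : Matrix.symplecticGroup (Fin (2 * n)) ℤ |
          ∃ γ : Matrix.SpecialLinearGroup (Fin 2) ℤ,
            (M : Matrix (Fin (2 * n) ⊕ Fin (2 * n)) (Fin (2 * n) ⊕ Fin (2 * n)) ℤ) =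
              Hembed n hn (γ : Matrix (Fin 2) (Fin 2) ℤ)}) = ⊤ := by
  refine SymplecticGroup.eq_top_of_parabolic_of_quarterTurn (k := lastIdx (2 * n) (by omega))
    (fun M hM => Subgroup.subset_closure (.inl hM)) (Subgroup.subset_closure (.inr ?_))
  refine ⟨⟨!![0, -1; 1, 0], by simp [det_fin_two]⟩, ?_⟩
  ext (i | i) (j | j) <;>
    simp only [SymplecticGroup.quarterTurn, Hembed, fromBlocks_apply₁₁, fromBlocks_apply₁₂,
      fromBlocks_apply₂₁, fromBlocks_apply₂₂, Matrix.sub_apply, Matrix.neg_apply,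
      one_apply, single_apply] <;>
    simp <;> grind
end
end
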